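/- For each fixed j ≥ 0, the proportion of labelled interval orders on {1, …, n} having exactly j unordered pairs of distinct elements with duplicated holdings tends, as n → ∞, to e^{-π²/12} · (π²/12)^j / j!. That is, the number of pairs of elements with duplicated holdings in a uniformly random labelled n-element interval order converges in distribution to a Poisson random variable with mean π²/12. -/

import Mathlib

open scoped Classical

/-- An interval order on `Fin n`: a strict partial order with no induced `2+2`. -/
def IntervalOrderRel (n : ℕ) : Type :=
  {r : Fin n → Fin n → Prop // IsStrictOrder (Fin n) r ∧
    ∀ a b c d, r a b → r c d → r a d ∨ r c b}

/-- Two interval orders on `Fin n` are isomorphic if some permutation of the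
ground set transforms one into the other. -/
def IntervalOrderIso {n : ℕ} (P Q : IntervalOrderRel n) : Prop :=
  ∃ e : Equiv.Perm (Fin n), ∀ a b, P.1 a b ↔ Q.1 (e a) (e b)

/-- `i n`: the number of unlabelled interval orders on `n` points, i.e. the number
of isomorphism classes of interval orders on an `n`-element set. -/
noncomputable def intervalOrderCount (n : ℕ) : ℕ :=
  Nat.card (Quot (IntervalOrderIso (n := n)))

/-- A poset is rigid if its only (order) automorphism is the identity. -/
def IsRigid {n : ℕ} (P : IntervalOrderRel n) : Prop :=
  ∀ e : Equiv.Perm (Fin n), (∀ a b, P.1 a b ↔ P.1 (e a) (e b)) → e = 1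

/-- `r n`: the number of unlabelled rigid interval orders on `n` points. -/
noncomputable def rigidIntervalOrderCount (n : ℕ) : ℕ :=
  Nat.card (Quot fun (P Q : {P : IntervalOrderRel n // IsRigid P}) =>
    IntervalOrderIso P.1 Q.1)

/-- `ℓ n`: the number of labelled interval orders on an `n`-element set. -/
noncomputable def labelledIntervalOrderCount (n : ℕ) : ℕ :=
  Nat.card (IntervalOrderRel n)

/-- `x` and `y` are distinct elements with duplicated holdings:
`D(x) = D(y)` and `U(x) = U(y)`. -/
def DupHoldings {n : ℕ} (P : IntervalOrderRel n) (x y : Fin n) : Prop :=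
  x ≠ y ∧ (∀ z, P.1 z x ↔ P.1 z y) ∧ (∀ z, P.1 x z ↔ P.1 y z)

/-- The number of unordered pairs `{x, y}` of distinct elements with duplicated
holdings. -/
noncomputable def dupPairCount {n : ℕ} (P : IntervalOrderRel n) : ℕ :=
  Nat.card {s : Finset (Fin n) // ∃ x y, DupHoldings P x y ∧ s = {x, y}}

/-- `P` has three distinct elements pairwise having duplicated holdings. -/
def HasDupTriple {n : ℕ} (P : IntervalOrderRel n) : Prop :=
  ∃ x y z : Fin n, x ≠ y ∧ x ≠ z ∧ y ≠ z ∧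
    DupHoldings P x y ∧ DupHoldings P x z ∧ DupHoldings P y z

/-- The Stirling number of the second kind `S(n, k)`: the number of partitions
of an `n`-element set into `k` non-empty parts. -/
noncomputable def stirling2 (n k : ℕ) : ℕ :=
  Nat.card {P : Finpartition (Finset.univ : Finset (Fin n)) // P.parts.card = k}

/-- The formal exponential series `e^{aX}`. -/
noncomputable def expSer {A : Type*} [CommRing A] [Algebra ℚ A] (a : A) : PowerSeries A :=
  PowerSeries.rescale a (PowerSeries.exp A)

section ExpSer

variable {A B : Type*} [CommRing A] [Algebra ℚ A] [CommRing B] [Algebra ℚ B]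

theorem expSer_add (a b : A) : expSer (a + b) = expSer a * expSer b :=
  (PowerSeries.exp_mul_exp_eq_exp_add a b).symm

@[simp]
theorem expSer_zero : expSer (0 : A) = 1 := by
  simp [expSer, PowerSeries.rescale_zero]

theorem coeff_expSer (n : ℕ) (a : A) :
    PowerSeries.coeff n (expSer a) = algebraMap ℚ A (1 / n.factorial) * a ^ n := by
  simp [expSer, PowerSeries.coeff_rescale, mul_comm]

@[simp]
theorem constantCoeff_expSer (a : A) : PowerSeries.constantCoeff (expSer a) = 1 := by
  rw [← PowerSeries.coeff_zero_eq_constantCoeff_apply, coeff_expSer]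
  simp

theorem expSer_pow (a : A) (k : ℕ) : expSer a ^ k = expSer (k * a) := by
  induction k with
  | zero => simp
  | succ k ih => rw [pow_succ, ih, ← expSer_add]; congr 1; push_cast; ring

theorem map_expSer (f : A →+* B) (a : A) :
    PowerSeries.map f (expSer a) = expSer (f a) := by
  ext n
  rw [PowerSeries.coeff_map, coeff_expSer, coeff_expSer, map_mul, map_pow]
  congr 1
  exact RingHom.map_rat_algebraMap f _

theorem X_dvd_one_sub_expSer (a : A) : (PowerSeries.X : PowerSeries A) ∣ 1 - expSer a := by
  rw [PowerSeries.X_dvd_iff]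
  simp

theorem expSer_mul_neg (a : A) : expSer a * expSer (-a) = 1 := by
  rw [← expSer_add]; simp

theorem sum_expSer_coeff_complex (n : ℕ) (a : ℂ) :
    PowerSeries.coeff n (expSer a) = a ^ n / n.factorial := by
  rw [coeff_expSer]; simp [div_eq_mul_inv, mul_comm]

end ExpSer

section MatrixSum

variable {R : Type*} [CommRing R]

/-- The signed sum over the sets `B ⊆ {0, …, k-1}` of forbidden columns of a lower triangular
`k × k` array, weighted by a function of the number of allowed columns. -/
noncomputable def columnSum (Q : ℕ → R) (k : ℕ) (g : ℕ → R) : R :=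
  ∑ B ∈ (Finset.range k).powerset,
    (-1) ^ B.card * (∏ r ∈ Finset.range k, (Q ((Finset.range (r + 1) \ B).card) - 1)) *
      g ((Finset.range k \ B).card)

/-- The transfer operator adding one index to `columnSum`. -/
def columnStep (Q : ℕ → R) (g : ℕ → R) (c : ℕ) : R :=
  (Q (c + 1) - 1) * g (c + 1) - (Q c - 1) * g c

theorem columnSum_succ (Q : ℕ → R) (k : ℕ) (g : ℕ → R) :
    columnSum Q (k + 1) g = columnSum Q k (columnStep Q g) := by
  unfold columnSum
  rw [Finset.range_add_one, Finset.sum_powerset_insert (by simp), ← Finset.sum_add_distrib]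
  refine Finset.sum_congr rfl fun B hB => ?_
  rw [Finset.mem_powerset] at hB
  have hk : k ∉ B := fun h => by simpa using hB h
  have e1 : (insert k (Finset.range k) \ B).card = (Finset.range k \ B).card + 1 := by
    rw [Finset.insert_sdiff_of_notMem _ hk, Finset.card_insert_of_notMem (by simp)]
  have e2 : (insert k (Finset.range k) \ insert k B) = (Finset.range k \ B) := by
    ext x; simp; grind
  have e3 : ∀ r ∈ Finset.range k, Q ((Finset.range (r + 1) \ insert k B).card) - 1
      = Q ((Finset.range (r + 1) \ B).card) - 1 := by
    intro r hr
    have : Finset.range (r + 1) \ insert k B = Finset.range (r + 1) \ B := by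
      ext x; simp at hr ⊢; grind
    rw [this]
  rw [Finset.prod_insert (by simp), Finset.prod_insert (by simp), Finset.range_add_one, e1, e2,
    Finset.card_insert_of_notMem hk, Finset.prod_congr rfl e3]
  unfold columnStep
  ring

theorem columnSum_eq_iterate (Q : ℕ → R) (k : ℕ) (g : ℕ → R) :
    columnSum Q k g = ((columnStep Q)^[k] g) 0 := by
  induction k generalizing g with
  | zero => simp [columnSum]
  | succ k ih => rw [columnSum_succ, ih, Function.iterate_succ_apply]

theorem pow_dvd_columnStep_iterate {Q : ℕ → R} {x : R} (hQ : ∀ c, x ∣ Q c - 1) (k c : ℕ) :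
    x ^ k ∣ ((columnStep Q)^[k] 1) c := by
  induction k generalizing c with
  | zero => simp
  | succ k ih =>
    rw [Function.iterate_succ_apply', columnStep, pow_succ']
    exact dvd_sub (mul_dvd_mul (hQ _) (ih _)) (mul_dvd_mul (hQ _) (ih _))

theorem pow_dvd_sum_columnSum_sub {Q Q' : ℕ → R} {x : R} (hQ : ∀ c, x ∣ Q c - 1)
    (hQQ' : ∀ c, Q c * Q' c = 1) (h0 : Q 0 = 1) (K : ℕ) :
    x ^ K ∣ ∑ k ∈ Finset.range K, columnSum Q k 1 -
      ∑ c ∈ Finset.range K, ∏ i ∈ Finset.range c, (1 - Q' (i + 1)) := by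
  set G : ℕ → R := fun c => ∑ k ∈ Finset.range K, ((columnStep Q)^[k] 1) c with hG
  have hstep : ∀ c, columnStep Q G c = G c - 1 + ((columnStep Q)^[K] 1) c := by
    intro c
    have h1 : columnStep Q G c = ∑ k ∈ Finset.range K, ((columnStep Q)^[k + 1] 1) c := by
      simp only [columnStep, hG, Finset.mul_sum, ← Finset.sum_sub_distrib,
        Function.iterate_succ_apply']
    rw [h1, hG]
    have := Finset.sum_range_succ' (fun k => ((columnStep Q)^[k] 1) c) K
    rw [Finset.sum_range_succ] at this
    simp only [Function.iterate_zero, id, Pi.one_apply] at this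
    linear_combination -this
  have hrec : ∀ c, x ^ K ∣ Q c * G c - (1 + (1 - Q' (c + 1)) * (Q (c + 1) * G (c + 1))) := by
    intro c
    have : Q c * G c - (1 + (1 - Q' (c + 1)) * (Q (c + 1) * G (c + 1))) =
        - ((columnStep Q)^[K] 1) c := by
      have h := hstep c
      rw [columnStep] at h
      linear_combination -h + G (c + 1) * hQQ' (c + 1)
    rw [this, dvd_neg]
    exact pow_dvd_columnStep_iterate hQ K c
  have hiter : ∀ m, x ^ K ∣ G 0 - (∑ c ∈ Finset.range m, ∏ i ∈ Finset.range c, (1 - Q' (i + 1)) +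
      (∏ i ∈ Finset.range m, (1 - Q' (i + 1))) * (Q m * G m)) := by
    intro m
    induction m with
    | zero => simp [h0]
    | succ m ih =>
      have := dvd_add ih ((hrec m).mul_left (∏ i ∈ Finset.range m, (1 - Q' (i + 1))))
      convert this using 1
      rw [Finset.sum_range_succ, Finset.prod_range_succ]
      ring
  have hprod : x ^ K ∣ ∏ i ∈ Finset.range K, (1 - Q' (i + 1)) := by
    have : ∏ i ∈ Finset.range K, x ∣ ∏ i ∈ Finset.range K, (1 - Q' (i + 1)) := by
      refine Finset.prod_dvd_prod_of_dvd _ _ fun i _ => ?_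
      have h := (hQ (i + 1)).mul_left (Q' (i + 1))
      convert h using 1
      linear_combination -hQQ' (i + 1)
    simpa using this
  have hfin := dvd_add (hiter K) (hprod.mul_right (Q K * G K))
  have hG0 : ∑ k ∈ Finset.range K, columnSum Q k 1 = G 0 := by
    simp only [hG, columnSum_eq_iterate]
  rw [hG0]
  convert hfin using 1
  ring

end MatrixSum

section StrangeSum

open Polynomial in
theorem eq_zero_of_add_comp_eq_zero {p : ℂ[X]} (h : p + p.comp (X + 1) = 0) : p = 0 := by
  have h1 : p.comp (X + C 1) = -p := by
    rw [map_one]; linear_combination h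
  have h2 := congrArg leadingCoeff h1
  rw [leadingCoeff_comp (by rw [natDegree_X_add_C]; exact one_ne_zero), leadingCoeff_neg,
    leadingCoeff_X_add_C, one_pow, mul_one] at h2
  exact leadingCoeff_eq_zero.mp (self_eq_neg.mp h2)

/-- The shift `s ↦ s + 1` on polynomials in `s`. -/
noncomputable def shiftHom : Polynomial ℂ →+* Polynomial ℂ :=
  Polynomial.compRingHom (Polynomial.X + 1)

theorem X_pow_dvd_of_add_mul_shift {K : ℕ} {E D : PowerSeries (Polynomial ℂ)}
    (hE : PowerSeries.constantCoeff E = 1)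
    (h : PowerSeries.X ^ K ∣ D + E * PowerSeries.map shiftHom D) : PowerSeries.X ^ K ∣ D := by
  rw [PowerSeries.X_pow_dvd_iff] at h ⊢
  intro n
  induction n using Nat.strong_induction_on with
  | _ n ih =>
    intro hn
    have h1 := h n hn
    rw [map_add, PowerSeries.coeff_mul, Finset.sum_eq_single (0, n)] at h1
    · rw [PowerSeries.coeff_zero_eq_constantCoeff_apply, hE, one_mul, PowerSeries.coeff_map] at h1
      exact eq_zero_of_add_comp_eq_zero h1
    · rintro ⟨i, j⟩ hij hne
      rw [Finset.HasAntidiagonal.mem_antidiagonal] at hij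
      have hj : j < n := by
        rcases Nat.eq_zero_or_pos i with rfl | hi
        · exact absurd (by simpa using hij) (by simpa using hne)
        · simp at hij; omega
      rw [PowerSeries.coeff_map, ih j hj (hj.trans hn), map_zero, mul_zero]
    · intro hmem; simp at hmem

theorem strange_sum_functional {R : Type*} [CommRing R] (x q : R) (K : ℕ) :
    ∑ n ∈ Finset.range K, (∏ i ∈ Finset.range (n + 1), (1 - q ^ i * x)) * x ^ n +
      q ^ 2 * x ^ 3 *
        ∑ n ∈ Finset.range K, (∏ i ∈ Finset.range (n + 1), (1 - q ^ i * (q * x))) * (q * x) ^ n =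
    1 - q * x ^ 2 - (∏ i ∈ Finset.range K, (1 - q ^ (i + 1) * x)) * (x ^ K * (1 - q ^ (K + 1) * x ^ 2)) := by
  induction K with
  | zero => simp
  | succ K ih =>
    have e1 : ∏ i ∈ Finset.range (K + 1), (1 - q ^ i * x) =
        (∏ i ∈ Finset.range K, (1 - q ^ (i + 1) * x)) * (1 - x) := by
      rw [Finset.prod_range_succ']; simp
    have e2 : ∏ i ∈ Finset.range (K + 1), (1 - q ^ i * (q * x)) =
        (∏ i ∈ Finset.range K, (1 - q ^ (i + 1) * x)) * (1 - q ^ (K + 1) * x) := by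
      rw [Finset.prod_range_succ, pow_succ, mul_assoc]
      congr 1
      exact Finset.prod_congr rfl fun i _ => by ring
    rw [Finset.sum_range_succ, Finset.sum_range_succ, e1, e2,
      Finset.prod_range_succ (fun i => (1 - q ^ (i + 1) * x))]
    set T := ∏ i ∈ Finset.range K, (1 - q ^ (i + 1) * x)
    rw [mul_pow]
    linear_combination ih

end StrangeSum

section Moments

variable {A : Type*} [CommRing A] [Algebra ℂ A]

/-- The `A`-linear functional on `A[η]` with moments `ν`. -/
noncomputable def momentMap (A : Type*) [CommRing A] [Algebra ℂ A] (ν : ℕ → ℂ) :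
    Polynomial A →ₗ[A] A :=
  Polynomial.lsum fun m => (algebraMap ℂ A (ν m)) • (LinearMap.id : A →ₗ[A] A)

@[simp]
theorem momentMap_X_pow (ν : ℕ → ℂ) (m : ℕ) :
    momentMap A ν (Polynomial.X ^ m) = algebraMap ℂ A (ν m) := by
  rw [momentMap, Polynomial.X_pow_eq_monomial]
  simp [Polynomial.lsum_apply, Algebra.algebraMap_eq_smul_one]

theorem momentMap_C_mul (ν : ℕ → ℂ) (a : A) (f : Polynomial A) :
    momentMap A ν (Polynomial.C a * f) = a * momentMap A ν f := by
  rw [← Polynomial.smul_eq_C_mul, map_smul, smul_eq_mul]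

theorem momentMap_map (ν : ℕ → ℂ) (f : Polynomial ℂ) :
    momentMap A ν (f.map (algebraMap ℂ A)) = algebraMap ℂ A (momentMap ℂ ν f) := by
  induction f using Polynomial.induction_on' with
  | add p q hp hq => simp [hp, hq]
  | monomial n a =>
    rw [← Polynomial.C_mul_X_pow_eq_monomial, Polynomial.map_mul, Polynomial.map_pow,
      Polynomial.map_X, Polynomial.map_C, momentMap_C_mul, momentMap_C_mul, map_mul]
    simp

/-- The exponential generating series of `ν` satisfies
`h(u) (1 + e^{-3u}) = e^{-u/2} - e^{-5u/2}`. -/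
def IsStrangeMoments (ν : ℕ → ℂ) : Prop :=
  PowerSeries.mk (fun m => ν m / m.factorial) * (1 + expSer (-3 : ℂ)) =
    expSer (-1 / 2 : ℂ) - expSer (-5 / 2 : ℂ)

theorem IsStrangeMoments.sum_eq {ν : ℕ → ℂ} (hν : IsStrangeMoments ν) (m : ℕ) :
    ν m + ∑ i ∈ Finset.range (m + 1), ν i * (-3) ^ (m - i) * (m.choose i) =
      (-1 / 2) ^ m - (-5 / 2) ^ m := by
  have h := congrArg (PowerSeries.coeff m) hν
  rw [mul_add, mul_one, map_add, PowerSeries.coeff_mul, PowerSeries.coeff_mk, map_sub,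
    sum_expSer_coeff_complex, sum_expSer_coeff_complex,
    Finset.Nat.sum_antidiagonal_eq_sum_range_succ_mk] at h
  have hm : (m.factorial : ℂ) ≠ 0 := by exact_mod_cast m.factorial_ne_zero
  have h2 : ∑ i ∈ Finset.range (m + 1), ν i * (-3) ^ (m - i) * (m.choose i) =
      m.factorial * ∑ k ∈ Finset.range m.succ, PowerSeries.coeff k
        (PowerSeries.mk fun m => ν m / ↑m.factorial) * PowerSeries.coeff (m - k) (expSer (-3)) := by
    rw [Finset.mul_sum]
    refine Finset.sum_congr rfl fun i hi => ?_
    have hi' : i ≤ m := by simpa [Nat.lt_succ_iff] using hi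
    rw [PowerSeries.coeff_mk, sum_expSer_coeff_complex, Nat.cast_choose ℂ hi']
    have := i.factorial_ne_zero
    have := (m - i).factorial_ne_zero
    field_simp
  rw [h2]
  simp only [] at h
  field_simp at h
  linear_combination h

theorem IsStrangeMoments.momentMap_add_comp {ν : ℕ → ℂ} (hν : IsStrangeMoments ν)
    (f : Polynomial A) :
    momentMap A ν f + momentMap A ν (f.comp (Polynomial.X - 3)) =
      f.eval (algebraMap ℂ A (-1 / 2)) - f.eval (algebraMap ℂ A (-5 / 2)) := by
  induction f using Polynomial.induction_on' with
  | add p q hp hq =>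
    simp only [map_add, Polynomial.add_comp, Polynomial.eval_add]
    linear_combination hp + hq
  | monomial n a =>
    have h3 : (Polynomial.X - 3 : Polynomial A) =
        Polynomial.X + Polynomial.C (algebraMap ℂ A (-3)) := by
      rw [map_neg, map_neg, map_ofNat, map_ofNat, sub_eq_add_neg]
    have h := congrArg (algebraMap ℂ A) (hν.sum_eq n)
    rw [← Polynomial.C_mul_X_pow_eq_monomial, Polynomial.mul_comp, Polynomial.C_comp,
      Polynomial.X_pow_comp, momentMap_C_mul, momentMap_C_mul, momentMap_X_pow, h3, add_pow, map_sum]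
    have e : ∀ i ∈ Finset.range (n + 1), momentMap A ν (Polynomial.X ^ i *
        Polynomial.C (algebraMap ℂ A (-3)) ^ (n - i) * (n.choose i : Polynomial A)) =
        algebraMap ℂ A (ν i * (-3) ^ (n - i) * (n.choose i)) := by
      intro i _
      have : (Polynomial.X ^ i * Polynomial.C (algebraMap ℂ A (-3)) ^ (n - i) *
          (n.choose i : Polynomial A)) =
          Polynomial.C (algebraMap ℂ A ((-3) ^ (n - i) * (n.choose i))) * Polynomial.X ^ i := by
        simp only [map_mul, map_pow, map_natCast]; ring
      rw [this, momentMap_C_mul, momentMap_X_pow, ← map_mul]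
      congr 1; ring
    rw [Finset.sum_congr rfl e, ← map_sum, ← mul_add, ← map_add, h]
    simp only [Polynomial.eval_mul, Polynomial.eval_C, Polynomial.eval_pow, Polynomial.eval_X,
      map_sub, map_pow]
    ring

/-- Coefficientwise application of `momentMap`. -/
noncomputable def momentSeries (ν : ℕ → ℂ) (F : PowerSeries (Polynomial A)) : PowerSeries A :=
  PowerSeries.mk fun n => momentMap A ν (PowerSeries.coeff n F)

theorem momentSeries_map_C_mul (ν : ℕ → ℂ) (f : PowerSeries A) (F : PowerSeries (Polynomial A)) :
    momentSeries ν (PowerSeries.map Polynomial.C f * F) = f * momentSeries ν F := by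
  ext n
  simp [momentSeries, PowerSeries.coeff_mul, momentMap_C_mul]

end Moments

section StrangeIdentity

open Polynomial (C X)

theorem IsStrangeMoments.momentSeries_expSer_add {A : Type*} [CommRing A] [Algebra ℂ A]
    [Algebra ℚ A] {ν : ℕ → ℂ} (hν : IsStrangeMoments ν) (f : Polynomial A) :
    momentSeries ν (expSer f) + momentSeries ν (expSer (f.comp (X - 3))) =
      expSer (f.eval (algebraMap ℂ A (-1 / 2))) - expSer (f.eval (algebraMap ℂ A (-5 / 2))) := by
  ext n
  have h := hν.momentMap_add_comp (f ^ n)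
  simp only [momentSeries, map_add, map_sub, PowerSeries.coeff_mk, coeff_expSer,
    Polynomial.algebraMap_apply, momentMap_C_mul]
  rw [Polynomial.pow_comp, Polynomial.eval_pow, Polynomial.eval_pow] at h
  linear_combination (algebraMap ℚ A (1 / n.factorial)) * h

theorem momentMap_map_shiftHom (ν : ℕ → ℂ) (f : Polynomial (Polynomial ℂ)) :
    momentMap (Polynomial ℂ) ν (f.map shiftHom) = shiftHom (momentMap (Polynomial ℂ) ν f) := by
  induction f using Polynomial.induction_on' with
  | add p q hp hq => simp [hp, hq]
  | monomial n a =>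
    rw [← Polynomial.C_mul_X_pow_eq_monomial, Polynomial.map_mul, Polynomial.map_pow,
      Polynomial.map_X, Polynomial.map_C, momentMap_C_mul, momentMap_C_mul, map_mul]
    simp [shiftHom, Polynomial.algebraMap_eq]

theorem map_shiftHom_momentSeries (ν : ℕ → ℂ) (f : Polynomial (Polynomial ℂ)) :
    PowerSeries.map shiftHom (momentSeries ν (expSer f)) =
      momentSeries ν (expSer (f.map shiftHom)) := by
  have h := map_expSer (Polynomial.mapRingHom shiftHom) f
  rw [Polynomial.coe_mapRingHom] at h
  rw [← h]
  ext1 n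
  simp only [momentSeries, PowerSeries.coeff_map, PowerSeries.coeff_mk,
    Polynomial.coe_mapRingHom, momentMap_map_shiftHom]

/-- The polynomial `-(η² - 1/4)/6`. -/
noncomputable def heatPoly : Polynomial ℂ := C (-1 / 6) * (X ^ 2 - C (1 / 4))

/-- The exponent `s (η + 1/2) - (η² - 1/4)/6`, as a polynomial in `η` over polynomials in `s`. -/
noncomputable def heatExponent : Polynomial (Polynomial ℂ) :=
  heatPoly.map C + C X * (X + C (C (1 / 2)))

theorem IsStrangeMoments.heat_functional {ν : ℕ → ℂ} (hν : IsStrangeMoments ν) :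
    momentSeries ν (expSer heatExponent) +
      expSer (-1 : Polynomial ℂ) ^ 2 * expSer (-X : Polynomial ℂ) ^ 3 *
        PowerSeries.map shiftHom (momentSeries ν (expSer heatExponent)) =
      1 - expSer (-1 : Polynomial ℂ) * expSer (-X : Polynomial ℂ) ^ 2 := by
  have h := hν.momentSeries_expSer_add heatExponent
  have hC : ∀ a : Polynomial ℂ, expSer (C a) = PowerSeries.map C (expSer a) := fun a =>
    (map_expSer C a).symm
  have e1 : heatExponent.comp (X - 3) =
      C (-X * 3 - 2) + heatExponent.map shiftHom := by
    simp only [heatExponent, heatPoly, shiftHom, Polynomial.map_add, Polynomial.map_mul,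
      Polynomial.map_sub, Polynomial.map_pow, Polynomial.map_X, Polynomial.map_C,
      Polynomial.add_comp, Polynomial.mul_comp, Polynomial.sub_comp, Polynomial.pow_comp,
      Polynomial.X_comp, Polynomial.C_comp, Polynomial.coe_compRingHom_apply]
    have k1 : (C (C (-1 / 6)) : Polynomial (Polynomial ℂ)) * C (C 6) = - 1 := by
      rw [← map_mul, ← map_mul]; norm_num
    have k2 : (C (C (1 / 2)) : Polynomial (Polynomial ℂ)) * C (C 2) = 1 := by
      rw [← map_mul, ← map_mul]; norm_num
    have k3 : (C (C 6) : Polynomial (Polynomial ℂ)) = 6 := by rw [map_ofNat, map_ofNat]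
    have k4 : (C (C 2) : Polynomial (Polynomial ℂ)) = 2 := by rw [map_ofNat, map_ofNat]
    simp only [map_sub, map_neg, map_mul, map_add, map_one, map_ofNat]
    rw [k3] at k1
    rw [k4] at k2
    have k5 : (C (C (-1 / 6)) : Polynomial (Polynomial ℂ)) * 3 = -(C (C (1 / 2)) : Polynomial (Polynomial ℂ)) := by
      have : (C (C 3) : Polynomial (Polynomial ℂ)) = 3 := by rw [map_ofNat, map_ofNat]
      rw [← this, ← map_mul, ← map_mul, ← map_neg, ← map_neg]; norm_num
    linear_combination (-X) * k1 + 3 * k5 - 2 * k2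
  have e2 : heatExponent.eval (algebraMap ℂ (Polynomial ℂ) (-1 / 2)) = 0 := by
    simp [heatExponent, heatPoly]
    rw [← map_pow, ← map_sub, ← map_mul, ← map_add]
    norm_num
  have e3 : heatExponent.eval (algebraMap ℂ (Polynomial ℂ) (-5 / 2)) = -1 + 2 * (-X) := by
    have k : (C (-1 / 6) * (C (-5 / 2) ^ 2 - C 4⁻¹) + X * (C (-5 / 2) + C 2⁻¹) : Polynomial ℂ) =
        C (-1) + X * C (-2) := by
      rw [← map_pow, ← map_sub, ← map_mul, ← map_add]
      norm_num
    simp [heatExponent, heatPoly, k]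
    rw [show (C 2 : Polynomial ℂ) = 2 from map_ofNat C 2]
  rw [e1, e2, e3, expSer_add, hC, momentSeries_map_C_mul, expSer_zero] at h
  rw [map_shiftHom_momentSeries]
  have e4 : expSer (-X * 3 - 2 : Polynomial ℂ) = expSer (-1 : Polynomial ℂ) ^ 2 *
      expSer (-X : Polynomial ℂ) ^ 3 := by
    rw [expSer_pow, expSer_pow, ← expSer_add]; congr 1; push_cast; ring
  have e5 : expSer (-1 + 2 * (-X) : Polynomial ℂ) = expSer (-1 : Polynomial ℂ) *
      expSer (-X : Polynomial ℂ) ^ 2 := by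
    rw [expSer_pow, ← expSer_add]; congr 1
  rw [← e4, ← e5]
  exact h

/-- The coefficientwise coefficient of `s`. -/
noncomputable def linearPart (F : PowerSeries (Polynomial ℂ)) : PowerSeries ℂ :=
  PowerSeries.mk fun n => (PowerSeries.coeff n F).coeff 1

theorem linearPart_mul {F G : PowerSeries (Polynomial ℂ)}
    (hF : PowerSeries.map (Polynomial.evalRingHom 0) F = 0) :
    linearPart (F * G) = linearPart F * PowerSeries.map (Polynomial.evalRingHom 0) G := by
  ext n
  simp only [linearPart, PowerSeries.coeff_mk, PowerSeries.coeff_mul, PowerSeries.coeff_map,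
    Polynomial.finsetSum_coeff]
  refine Finset.sum_congr rfl fun x _ => ?_
  have h0 : (PowerSeries.coeff x.1 F).coeff 0 = 0 := by
    have := congrArg (PowerSeries.coeff x.1) hF
    rwa [PowerSeries.coeff_map, Polynomial.coe_evalRingHom, ← Polynomial.coeff_zero_eq_eval_zero,
      map_zero] at this
  rw [Polynomial.mul_coeff_one, h0, Polynomial.coe_evalRingHom,
    ← Polynomial.coeff_zero_eq_eval_zero]
  ring

theorem linearPart_sum {ι : Type*} (s : Finset ι) (F : ι → PowerSeries (Polynomial ℂ)) :
    linearPart (∑ i ∈ s, F i) = ∑ i ∈ s, linearPart (F i) := by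
  ext n
  simp [linearPart]

theorem linearPart_strange_sum (K : ℕ) :
    linearPart (∑ n ∈ Finset.range K, (∏ i ∈ Finset.range (n + 1),
      (1 - expSer (-1 : Polynomial ℂ) ^ i * expSer (-X : Polynomial ℂ))) *
        expSer (-X : Polynomial ℂ) ^ n) =
    PowerSeries.X * ∑ c ∈ Finset.range K,
      ∏ i ∈ Finset.range c, (1 - expSer (-((i + 1 : ℕ) : ℂ))) := by
  rw [linearPart_sum, Finset.mul_sum]
  refine Finset.sum_congr rfl fun n _ => ?_
  have hev : PowerSeries.map (Polynomial.evalRingHom (0 : ℂ)) (expSer (-X : Polynomial ℂ)) = 1 := by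
    rw [map_expSer]; simp
  have hev1 : PowerSeries.map (Polynomial.evalRingHom (0 : ℂ)) (expSer (-1 : Polynomial ℂ)) =
      expSer (-1) := by
    rw [map_expSer]; simp
  have hlin : linearPart (1 - expSer (-X : Polynomial ℂ)) = PowerSeries.X := by
    ext m
    rw [linearPart, PowerSeries.coeff_mk, map_sub, coeff_expSer, PowerSeries.coeff_X,
      PowerSeries.coeff_one, Polynomial.algebraMap_apply, neg_pow, ← mul_assoc, ← map_one C,
      ← map_neg, ← map_pow, ← map_mul, Polynomial.coeff_sub, Polynomial.coeff_C_mul,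
      Polynomial.coeff_X_pow]
    by_cases hm : m = 1
    · subst hm; simp
    · rw [if_neg hm, if_neg (Ne.symm hm)]
      split_ifs <;> simp [Polynomial.coeff_one]
  rw [Finset.prod_range_succ', pow_zero, one_mul, mul_comm (Finset.prod _ _), mul_assoc,
    linearPart_mul (by rw [map_sub, hev]; simp), hlin]
  congr 1
  rw [map_mul, map_pow, hev, one_pow, mul_one, map_prod]
  refine Finset.prod_congr rfl fun i _ => ?_
  rw [map_sub, map_mul, map_pow, hev, hev1, mul_one, map_one, expSer_pow]
  simp

theorem IsStrangeMoments.coeff_sum_prod {ν : ℕ → ℂ} (hν : IsStrangeMoments ν) {n K : ℕ}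
    (hK : n + 1 < K) :
    (n.factorial : ℂ) * PowerSeries.coeff n (∑ c ∈ Finset.range K,
      ∏ i ∈ Finset.range c, (1 - expSer (-((i + 1 : ℕ) : ℂ)))) =
    momentMap ℂ ν (heatPoly ^ n * (X + C (1 / 2))) := by
  set S := ∑ n ∈ Finset.range K, (∏ i ∈ Finset.range (n + 1),
      (1 - expSer (-1 : Polynomial ℂ) ^ i * expSer (-X : Polynomial ℂ))) *
        expSer (-X : Polynomial ℂ) ^ n with hS
  set H := momentSeries ν (expSer heatExponent) with hH
  have hdvd : PowerSeries.X ^ K ∣ S - H := by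
    refine X_pow_dvd_of_add_mul_shift
      (E := expSer (-1 : Polynomial ℂ) ^ 2 * expSer (-X : Polynomial ℂ) ^ 3) (by simp) ?_
    have h1 := strange_sum_functional (expSer (-X : Polynomial ℂ)) (expSer (-1 : Polynomial ℂ)) K
    have h2 := hν.heat_functional
    rw [← hH] at h2
    have hs1 : PowerSeries.map shiftHom (expSer (-1 : Polynomial ℂ)) = expSer (-1) := by
      rw [map_expSer]; simp
    have hs2 : PowerSeries.map shiftHom (expSer (-X : Polynomial ℂ)) =
        expSer (-1 : Polynomial ℂ) * expSer (-X : Polynomial ℂ) := by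
      rw [map_expSer, ← expSer_add]; simp [shiftHom]
    have h3 : PowerSeries.map shiftHom S = ∑ n ∈ Finset.range K, (∏ i ∈ Finset.range (n + 1),
      (1 - expSer (-1 : Polynomial ℂ) ^ i * (expSer (-1 : Polynomial ℂ) *
        expSer (-X : Polynomial ℂ)))) *
        (expSer (-1 : Polynomial ℂ) * expSer (-X : Polynomial ℂ)) ^ n := by
      simp only [hS, map_sum, map_mul, map_prod, map_sub, map_pow, map_one, hs1, hs2]
    rw [← h3, ← hS] at h1
    have hT : (PowerSeries.X : PowerSeries (Polynomial ℂ)) ^ K ∣ ∏ i ∈ Finset.range K,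
        (1 - expSer (-1 : Polynomial ℂ) ^ (i + 1) * expSer (-X : Polynomial ℂ)) := by
      have : ∏ i ∈ Finset.range K, (PowerSeries.X : PowerSeries (Polynomial ℂ)) ∣
          ∏ i ∈ Finset.range K,
            (1 - expSer (-1 : Polynomial ℂ) ^ (i + 1) * expSer (-X : Polynomial ℂ)) := by
        refine Finset.prod_dvd_prod_of_dvd _ _ fun i _ => ?_
        rw [expSer_pow, ← expSer_add]
        exact X_dvd_one_sub_expSer _
      simpa using this
    have h4 := (hT.mul_right (expSer (-X : Polynomial ℂ) ^ K *
      (1 - expSer (-1 : Polynomial ℂ) ^ (K + 1) * expSer (-X : Polynomial ℂ) ^ 2)))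
    rw [← dvd_neg] at h4
    convert h4 using 1
    rw [map_sub]
    linear_combination h1 - h2
  have h1 : PowerSeries.coeff (n + 1) S = PowerSeries.coeff (n + 1) H := by
    rw [PowerSeries.X_pow_dvd_iff] at hdvd
    have := hdvd (n + 1) hK
    rwa [map_sub, sub_eq_zero] at this
  have h2 := congrArg (PowerSeries.coeff (n + 1)) (linearPart_strange_sum K)
  rw [PowerSeries.coeff_succ_X_mul, ← hS, linearPart, PowerSeries.coeff_mk, h1] at h2
  rw [← h2, hH, momentSeries, PowerSeries.coeff_mk, coeff_expSer, Polynomial.algebraMap_apply,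
    momentMap_C_mul, Polynomial.algebraMap_apply, Polynomial.coeff_C_mul]
  obtain ⟨k, hk⟩ := Polynomial.powAddExpansion (heatPoly.map C) (C X * (X + C (C (1 / 2)))) (n + 1)
  rw [heatExponent, hk]
  have e1 : ((heatPoly.map C) ^ (n + 1) + ((n + 1 : ℕ) : Polynomial (Polynomial ℂ)) *
      (heatPoly.map C) ^ (n + 1 - 1) * (C X * (X + C (C (1 / 2)))) +
      k * (C X * (X + C (C (1 / 2)))) ^ 2) =
      (heatPoly ^ (n + 1)).map (algebraMap ℂ (Polynomial ℂ)) +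
      C (((n + 1 : ℕ) : Polynomial ℂ) * X) *
        (heatPoly ^ n * (X + C (1 / 2))).map (algebraMap ℂ (Polynomial ℂ)) +
      C (X ^ 2) * (k * (X + C (C (1 / 2))) ^ 2) := by
    simp only [Polynomial.algebraMap_eq, Polynomial.map_mul, Polynomial.map_pow,
      Polynomial.map_add, Polynomial.map_X, Polynomial.map_C, map_mul, map_pow, map_natCast,
      Nat.add_sub_cancel]
    ring
  rw [e1, map_add, map_add, momentMap_C_mul, momentMap_C_mul, momentMap_map, momentMap_map]
  have e2 : ∀ a b : ℂ, ∀ g : Polynomial ℂ, (algebraMap ℂ (Polynomial ℂ) a +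
      ((n + 1 : ℕ) : Polynomial ℂ) * X * algebraMap ℂ (Polynomial ℂ) b + X ^ 2 * g).coeff 1 =
      (n + 1 : ℕ) * b := by
    intro a b g
    have : (((n + 1 : ℕ) : Polynomial ℂ) * X * algebraMap ℂ (Polynomial ℂ) b) =
        C ((n + 1 : ℕ) * b) * X := by
      rw [Polynomial.algebraMap_eq, map_mul, map_natCast]; ring
    rw [this]
    simp [Polynomial.coeff_X_pow_mul', Polynomial.algebraMap_eq, Polynomial.coeff_C]
  rw [e2]
  have hf : ((n + 1).factorial : ℂ) ≠ 0 := by exact_mod_cast (n + 1).factorial_ne_zero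
  have hf' : (n.factorial : ℂ) ≠ 0 := by exact_mod_cast n.factorial_ne_zero
  rw [Nat.factorial_succ] at hf ⊢
  have hn : ((n : ℂ) + 1) ≠ 0 := by exact_mod_cast n.succ_ne_zero
  simp
  field_simp

end StrangeIdentity

section TaylorSeries

/-- The Taylor series at `0` of a complex function. -/
noncomputable def taylorSer (f : ℂ → ℂ) : PowerSeries ℂ :=
  PowerSeries.mk fun n => iteratedDeriv n f 0 / n.factorial

theorem taylorSer_congr {f g : ℂ → ℂ} (h : f =ᶠ[nhds 0] g) : taylorSer f = taylorSer g := by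
  ext n
  rw [taylorSer, taylorSer, PowerSeries.coeff_mk, PowerSeries.coeff_mk, h.iteratedDeriv_eq]

theorem taylorSer_mul {f g : ℂ → ℂ} (hf : AnalyticAt ℂ f 0) (hg : AnalyticAt ℂ g 0) :
    taylorSer (fun u => f u * g u) = taylorSer f * taylorSer g := by
  ext n
  rw [taylorSer, taylorSer, taylorSer, PowerSeries.coeff_mk, PowerSeries.coeff_mul,
    iteratedDeriv_fun_mul hf.contDiffAt hg.contDiffAt,
    Finset.Nat.sum_antidiagonal_eq_sum_range_succ_mk, Finset.sum_div]
  refine Finset.sum_congr rfl fun i hi => ?_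
  have hi' : i ≤ n := by simpa [Nat.lt_succ_iff] using hi
  rw [PowerSeries.coeff_mk, PowerSeries.coeff_mk, Nat.cast_choose ℂ hi']
  have h1 : (n.factorial : ℂ) ≠ 0 := by exact_mod_cast n.factorial_ne_zero
  have h2 : (i.factorial : ℂ) ≠ 0 := by exact_mod_cast i.factorial_ne_zero
  have h3 : ((n - i).factorial : ℂ) ≠ 0 := by exact_mod_cast (n - i).factorial_ne_zero
  field_simp

theorem taylorSer_add {f g : ℂ → ℂ} (hf : AnalyticAt ℂ f 0) (hg : AnalyticAt ℂ g 0) :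
    taylorSer (fun u => f u + g u) = taylorSer f + taylorSer g := by
  ext n
  rw [taylorSer, taylorSer, taylorSer, map_add, PowerSeries.coeff_mk, PowerSeries.coeff_mk,
    PowerSeries.coeff_mk, iteratedDeriv_fun_add hf.contDiffAt hg.contDiffAt, add_div]

theorem taylorSer_sub {f g : ℂ → ℂ} (hf : AnalyticAt ℂ f 0) (hg : AnalyticAt ℂ g 0) :
    taylorSer (fun u => f u - g u) = taylorSer f - taylorSer g := by
  ext n
  rw [taylorSer, taylorSer, taylorSer, map_sub, PowerSeries.coeff_mk, PowerSeries.coeff_mk,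
    PowerSeries.coeff_mk, iteratedDeriv_fun_sub hf.contDiffAt hg.contDiffAt, sub_div]

theorem taylorSer_const (c : ℂ) : taylorSer (fun _ => c) = PowerSeries.C c := by
  ext n
  rw [taylorSer, PowerSeries.coeff_mk, iteratedDeriv_const, PowerSeries.coeff_C]
  split_ifs with h
  · simp [h]
  · simp

theorem taylorSer_id : taylorSer (fun u => u) = PowerSeries.X := by
  ext n
  rw [taylorSer, PowerSeries.coeff_mk, iteratedDeriv_fun_id_zero, PowerSeries.coeff_X]
  split_ifs with h
  · simp [h]
  · simp

theorem taylorSer_exp (c : ℂ) : taylorSer (fun u => Complex.exp (c * u)) = expSer c := by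
  ext n
  rw [taylorSer, PowerSeries.coeff_mk, iteratedDeriv_cexp_const_mul, sum_expSer_coeff_complex]
  simp

end TaylorSeries

section MomentSeriesExistence

/-- The entire function `sin z / z`. -/
noncomputable def sincC : ℂ → ℂ := dslope Complex.sin 0

theorem mul_sincC (z : ℂ) : z * sincC z = Complex.sin z := by
  have := sub_smul_dslope Complex.sin 0 z
  simpa [sincC] using this

theorem sincC_zero : sincC 0 = 1 := by
  simp [sincC]

theorem differentiable_sincC : Differentiable ℂ sincC := by
  rw [← differentiableOn_univ]
  exact (Complex.differentiableOn_dslope Filter.univ_mem).mpr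
    Complex.differentiable_sin.differentiableOn

theorem sincC_ne_zero {z : ℂ} (hz : ‖z‖ < Real.pi) : sincC z ≠ 0 := by
  intro h
  have h1 := mul_sincC z
  rw [h, mul_zero] at h1
  obtain ⟨k, hk⟩ := Complex.sin_eq_zero_iff.mp h1.symm
  have h2 : |(k : ℝ)| * Real.pi < 1 * Real.pi := by
    rw [hk, norm_mul, Complex.norm_intCast, Complex.norm_real, Real.norm_of_nonneg Real.pi_pos.le]
      at hz
    linarith
  have h3 : |(k : ℝ)| < 1 := lt_of_mul_lt_mul_right h2 Real.pi_pos.le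
  have h4 : k = 0 := by
    rw [← Int.abs_lt_one_iff]; exact_mod_cast h3
  rw [hk, h4] at h
  simp [sincC_zero] at h

/-- The holomorphic part of `2 sinh (u / 2) / (2 cosh u - 1)` once the poles `± iπ / 3` are
removed. -/
noncomputable def poleFreePart (u : ℂ) : ℂ :=
  2 * Complex.sinh (u / 2) /
    (sincC ((Real.pi / 3 + Complex.I * u) / 2) * sincC ((Real.pi / 3 - Complex.I * u) / 2))

theorem norm_arg_lt {u : ℂ} (hu : u ∈ Metric.ball (0 : ℂ) 2) (s : ℂ) (hs : ‖s‖ = 1) :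
    ‖((Real.pi / 3 + s * u) / 2 : ℂ)‖ < Real.pi := by
  rw [mem_ball_zero_iff] at hu
  have h0 := Real.pi_gt_three
  have h1 : ‖(Real.pi / 3 : ℂ)‖ = Real.pi / 3 := by
    rw [norm_div, Complex.norm_real, Real.norm_of_nonneg Real.pi_pos.le]; simp
  have h2 := norm_add_le (Real.pi / 3 : ℂ) (s * u)
  rw [norm_mul, hs, one_mul, h1] at h2
  rw [norm_div, Complex.norm_ofNat]
  linarith

theorem sincC_args_ne_zero {u : ℂ} (hu : u ∈ Metric.ball (0 : ℂ) 2) :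
    sincC ((Real.pi / 3 + Complex.I * u) / 2) * sincC ((Real.pi / 3 - Complex.I * u) / 2) ≠ 0 := by
  refine mul_ne_zero (sincC_ne_zero (norm_arg_lt hu _ (by simp))) (sincC_ne_zero ?_)
  have := norm_arg_lt hu (-Complex.I) (by simp)
  rwa [neg_mul, ← sub_eq_add_neg] at this

theorem differentiableOn_poleFreePart : DifferentiableOn ℂ poleFreePart (Metric.ball 0 2) := by
  intro u hu
  refine DifferentiableAt.differentiableWithinAt ?_
  unfold poleFreePart
  refine DifferentiableAt.div ?_ ?_ (sincC_args_ne_zero hu)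
  · fun_prop
  · refine DifferentiableAt.mul ?_ ?_
    · exact (differentiable_sincC _).comp u (f := fun u : ℂ => (Real.pi / 3 + Complex.I * u) / 2) (by fun_prop)
    · exact (differentiable_sincC _).comp u (f := fun u : ℂ => (Real.pi / 3 - Complex.I * u) / 2) (by fun_prop)

theorem two_cosh_sub_one (u : ℂ) :
    2 * Complex.cosh u - 1 = (u ^ 2 + Real.pi ^ 2 / 9) *
      (sincC ((Real.pi / 3 + Complex.I * u) / 2) * sincC ((Real.pi / 3 - Complex.I * u) / 2)) := by
  have h1 := mul_sincC ((Real.pi / 3 + Complex.I * u) / 2)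
  have h2 := mul_sincC ((Real.pi / 3 - Complex.I * u) / 2)
  have h3 := Complex.cos_sub_cos (Complex.I * u) (Real.pi / 3)
  have h4 : Complex.cos (Real.pi / 3) = 1 / 2 := by
    have := congrArg (fun x : ℝ => (x : ℂ)) Real.cos_pi_div_three
    push_cast at this
    exact this
  have h5 : Complex.cos (Complex.I * u) = Complex.cosh u := by
    rw [mul_comm, Complex.cos_mul_I]
  have e1 : (Complex.I * u + Real.pi / 3) / 2 = (Real.pi / 3 + Complex.I * u) / 2 := by ring
  have e2 : (Complex.I * u - Real.pi / 3) / 2 = -((Real.pi / 3 - Complex.I * u) / 2) := by ring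
  rw [h4, h5, e1, e2, Complex.sin_neg, ← h1, ← h2] at h3
  have h6 := Complex.I_sq
  linear_combination 2 * h3 - u ^ 2 *
    (sincC ((Real.pi / 3 + Complex.I * u) / 2) * sincC ((Real.pi / 3 - Complex.I * u) / 2)) * h6

theorem poleFreePart_mul {u : ℂ} (hu : u ∈ Metric.ball (0 : ℂ) 2) :
    poleFreePart u * (1 + Complex.exp (-3 * u)) =
      (u * u + Real.pi ^ 2 / 9) * (Complex.exp (-1 / 2 * u) - Complex.exp (-5 / 2 * u)) := by
  have h0 := sincC_args_ne_zero hu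
  have h1 := two_cosh_sub_one u
  set P := sincC ((Real.pi / 3 + Complex.I * u) / 2) * sincC ((Real.pi / 3 - Complex.I * u) / 2)
    with hP
  have h2 : poleFreePart u * P = 2 * Complex.sinh (u / 2) := by
    rw [poleFreePart, ← hP, div_mul_cancel₀ _ h0]
  apply mul_right_cancel₀ h0
  set x := Complex.exp (-1 / 2 * u) with hx
  set y := Complex.exp (u / 2) with hy
  have hxy : x * y = 1 := by
    rw [hx, hy, ← Complex.exp_add]; ring_nf; simp
  have e3 : Complex.exp (-3 * u) = x ^ 6 := by
    rw [hx, ← Complex.exp_nat_mul]; congr 1; push_cast; ring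
  have e5 : Complex.exp (-5 / 2 * u) = x ^ 5 := by
    rw [hx, ← Complex.exp_nat_mul]; congr 1; push_cast; ring
  have ec : 2 * Complex.cosh u = y ^ 2 + x ^ 2 := by
    rw [Complex.two_cosh, hx, hy, ← Complex.exp_nat_mul, ← Complex.exp_nat_mul]
    congr 2 <;> push_cast <;> ring
  have es : 2 * Complex.sinh (u / 2) = y - x := by
    rw [Complex.two_sinh, hx, hy]
    congr 2; ring
  rw [e3, e5]
  rw [ec] at h1
  rw [es] at h2
  have k1 : (y ^ 2 + x ^ 2 - 1) * x ^ 4 * (1 + x ^ 2) = x ^ 2 * (1 + x ^ 6) := by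
    linear_combination (x ^ 2 * (1 + x ^ 2) * (x * y + 1)) * hxy
  have k2 : (y - x) * (1 + x ^ 6) = (y ^ 2 + x ^ 2 - 1) * (x - x ^ 5) := by
    have hx0 : x ^ 2 ≠ 0 := pow_ne_zero _ (Complex.exp_ne_zero _)
    apply mul_right_cancel₀ hx0
    linear_combination (x - y) * k1 + (y ^ 2 + x ^ 2 - 1) * x ^ 3 * (1 + x ^ 2) * hxy
  linear_combination (1 + x ^ 6) * h2 + k2 + (x - x ^ 5) * h1

theorem analyticAt_poleFreePart : AnalyticAt ℂ poleFreePart 0 :=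
  differentiableOn_poleFreePart.analyticAt (Metric.ball_mem_nhds _ two_pos)

theorem taylorSer_poleFreePart :
    taylorSer poleFreePart * (1 + expSer (-3 : ℂ)) =
      (PowerSeries.X ^ 2 + PowerSeries.C (Real.pi ^ 2 / 9 : ℂ)) *
        (expSer (-1 / 2 : ℂ) - expSer (-5 / 2 : ℂ)) := by
  have hexp : ∀ c : ℂ, AnalyticAt ℂ (fun u => Complex.exp (c * u)) 0 := fun c => by fun_prop
  have h1 : taylorSer (fun u => poleFreePart u * (1 + Complex.exp (-3 * u))) =
      taylorSer (fun u => (u * u + Real.pi ^ 2 / 9) *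
        (Complex.exp (-1 / 2 * u) - Complex.exp (-5 / 2 * u))) :=
    taylorSer_congr (Filter.eventuallyEq_of_mem (Metric.ball_mem_nhds _ two_pos)
      fun u hu => poleFreePart_mul hu)
  rw [taylorSer_mul analyticAt_poleFreePart (by fun_prop), taylorSer_add (by fun_prop) (hexp _),
    taylorSer_const, taylorSer_exp, taylorSer_mul (by fun_prop) (by fun_prop),
    taylorSer_add (by fun_prop) (by fun_prop), taylorSer_mul (by fun_prop) (by fun_prop),
    taylorSer_id, taylorSer_const, taylorSer_sub (hexp _) (hexp _), taylorSer_exp, taylorSer_exp,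
    map_one] at h1
  rw [h1, sq PowerSeries.X]

theorem constantCoeff_denominator_ne_zero :
    PowerSeries.constantCoeff
      (PowerSeries.X ^ 2 + PowerSeries.C (Real.pi ^ 2 / 9 : ℂ) : PowerSeries ℂ) ≠ 0 := by
  have : (Real.pi : ℂ) ≠ 0 := by exact_mod_cast Real.pi_ne_zero
  simp [this]

/-- The Taylor series of `2 sinh (u / 2) / (2 cosh u - 1)`. -/
noncomputable def sechSer : PowerSeries ℂ :=
  taylorSer poleFreePart * (PowerSeries.X ^ 2 + PowerSeries.C (Real.pi ^ 2 / 9 : ℂ))⁻¹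

theorem sechSer_mul_denominator :
    sechSer * (PowerSeries.X ^ 2 + PowerSeries.C (Real.pi ^ 2 / 9 : ℂ)) =
      taylorSer poleFreePart := by
  rw [sechSer, mul_assoc, PowerSeries.inv_mul_cancel _ constantCoeff_denominator_ne_zero, mul_one]

theorem sechSer_mul :
    sechSer * (1 + expSer (-3 : ℂ)) = expSer (-1 / 2 : ℂ) - expSer (-5 / 2 : ℂ) := by
  have h0 : (PowerSeries.X ^ 2 + PowerSeries.C (Real.pi ^ 2 / 9 : ℂ) : PowerSeries ℂ) ≠ 0 := by
    intro h
    exact constantCoeff_denominator_ne_zero (by rw [h, map_zero])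
  apply mul_left_cancel₀ h0
  rw [← taylorSer_poleFreePart, ← sechSer_mul_denominator]
  ring

theorem rescale_expSer (c a : ℂ) : PowerSeries.rescale c (expSer a) = expSer (c * a) := by
  ext n
  rw [PowerSeries.coeff_rescale, sum_expSer_coeff_complex, sum_expSer_coeff_complex, mul_pow,
    mul_div_assoc]

theorem rescale_sechSer : PowerSeries.rescale (-1 : ℂ) sechSer = -sechSer := by
  have h0 : (1 + expSer (-3 : ℂ)) ≠ 0 := by
    intro h
    have := congrArg PowerSeries.constantCoeff h
    rw [map_add, map_one, constantCoeff_expSer, map_zero] at this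
    norm_num at this
  have h1 := congrArg (PowerSeries.rescale (-1 : ℂ)) sechSer_mul
  rw [map_mul, map_add, map_sub, map_one, rescale_expSer, rescale_expSer, rescale_expSer] at h1
  apply mul_right_cancel₀ h0
  rw [neg_mul, sechSer_mul]
  have e1 : expSer (-1 * -3 : ℂ) * expSer (-3 : ℂ) = 1 := by
    rw [← expSer_add]; norm_num
  have e2 : expSer (-1 * (-1 / 2) : ℂ) * expSer (-3 : ℂ) = expSer (-5 / 2 : ℂ) := by
    rw [← expSer_add]; norm_num
  have e3 : expSer (-1 * (-5 / 2) : ℂ) * expSer (-3 : ℂ) = expSer (-1 / 2 : ℂ) := by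
    rw [← expSer_add]; norm_num
  linear_combination expSer (-3 : ℂ) * h1 - PowerSeries.rescale (-1 : ℂ) sechSer * e1 + e2 - e3

theorem coeff_sechSer_even (k : ℕ) : PowerSeries.coeff (2 * k) sechSer = 0 := by
  have h := congrArg (PowerSeries.coeff (2 * k)) rescale_sechSer
  rw [PowerSeries.coeff_rescale, map_neg, pow_mul, neg_one_sq, one_pow, one_mul] at h
  exact self_eq_neg.mp h

theorem coeff_taylorSer_poleFreePart_add_two (n : ℕ) :
    PowerSeries.coeff (n + 2) (taylorSer poleFreePart) =
      PowerSeries.coeff n sechSer + PowerSeries.coeff (n + 2) sechSer * (Real.pi ^ 2 / 9) := by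
  rw [← sechSer_mul_denominator, mul_add, map_add, PowerSeries.coeff_mul_X_pow,
    PowerSeries.coeff_mul_C]

theorem coeff_taylorSer_poleFreePart_of_lt {n : ℕ} (hn : n < 2) :
    PowerSeries.coeff n (taylorSer poleFreePart) =
      PowerSeries.coeff n sechSer * (Real.pi ^ 2 / 9) := by
  rw [← sechSer_mul_denominator, mul_add, map_add, PowerSeries.coeff_mul_X_pow',
    PowerSeries.coeff_mul_C, if_neg (by omega), zero_add]

theorem coeff_taylorSer_poleFreePart_even (k : ℕ) :
    PowerSeries.coeff (2 * k) (taylorSer poleFreePart) = 0 := by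
  cases k with
  | zero => rw [coeff_taylorSer_poleFreePart_of_lt (by norm_num), coeff_sechSer_even, zero_mul]
  | succ k =>
    rw [mul_add, mul_one, coeff_taylorSer_poleFreePart_add_two, coeff_sechSer_even,
      show 2 * k + 2 = 2 * (k + 1) by ring, coeff_sechSer_even, zero_mul, add_zero]

theorem sum_coeff_taylorSer_poleFreePart (k : ℕ) :
    ∑ n ∈ Finset.range (2 * (k + 1)),
        PowerSeries.coeff n (taylorSer poleFreePart) * (Complex.I * (Real.pi / 3)) ^ n =
      Complex.I * (Real.pi / 3) *
        ((-1) ^ k * PowerSeries.coeff (2 * k + 1) sechSer * (Real.pi ^ 2 / 9) ^ (k + 1)) := by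
  have hI : ∀ m : ℕ, (Complex.I * (Real.pi / 3)) ^ (2 * m + 1) =
      Complex.I * (Real.pi / 3) * ((-1) ^ m * (Real.pi ^ 2 / 9 : ℂ) ^ m) := by
    intro m
    rw [pow_succ', pow_mul, mul_pow Complex.I, Complex.I_sq, ← mul_pow]
    congr 2; ring
  induction k with
  | zero =>
    have h0 := coeff_taylorSer_poleFreePart_even 0
    rw [mul_zero] at h0
    rw [show 2 * (0 + 1) = 0 + 1 + 1 by norm_num, Finset.sum_range_succ, Finset.sum_range_succ, h0,
      coeff_taylorSer_poleFreePart_of_lt (by norm_num)]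
    simp
    ring
  | succ k ih =>
    rw [show 2 * (k + 1 + 1) = 2 * (k + 1) + 1 + 1 by ring, Finset.sum_range_succ,
      Finset.sum_range_succ, ih, coeff_taylorSer_poleFreePart_even, hI,
      show 2 * (k + 1) + 1 = 2 * k + 1 + 2 by ring, coeff_taylorSer_poleFreePart_add_two]
    ring

theorem poleFreePart_pole_ne_zero : poleFreePart (Complex.I * (Real.pi / 3)) ≠ 0 := by
  have hmem : Complex.I * (Real.pi / 3) ∈ Metric.ball (0 : ℂ) 2 := by
    rw [mem_ball_zero_iff, norm_mul, Complex.norm_I, one_mul, norm_div, Complex.norm_real,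
      Real.norm_of_nonneg Real.pi_pos.le, Complex.norm_ofNat]
    linarith [Real.pi_lt_four]
  refine div_ne_zero (mul_ne_zero two_ne_zero ?_) (sincC_args_ne_zero hmem)
  have e : Complex.I * (Real.pi / 3) / 2 = ((Real.pi / 6 : ℝ) : ℂ) * Complex.I := by
    push_cast; ring
  rw [e, Complex.sinh_mul_I, ← Complex.ofReal_sin, Real.sin_pi_div_six]
  simp

theorem exists_isStrangeMoments :
    ∃ ν : ℕ → ℂ, IsStrangeMoments ν ∧ (∀ k, ν (2 * k) = 0) ∧ ∃ c : ℂ, c ≠ 0 ∧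
      Filter.Tendsto (fun k : ℕ => (-1) ^ k * (ν (2 * k + 1) / (2 * k + 1).factorial) *
        (Real.pi ^ 2 / 9 : ℂ) ^ k) Filter.atTop (nhds c) := by
  have hfac : ∀ m : ℕ, (m.factorial : ℂ) ≠ 0 := fun m => by exact_mod_cast m.factorial_ne_zero
  have hpi : (Real.pi : ℂ) ≠ 0 := by exact_mod_cast Real.pi_ne_zero
  have hz : Complex.I * (Real.pi / 3) ≠ 0 := by simp [hpi]
  have hmem : Complex.I * (Real.pi / 3) ∈ Metric.ball (0 : ℂ) 2 := by
    rw [mem_ball_zero_iff, norm_mul, Complex.norm_I, one_mul, norm_div, Complex.norm_real,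
      Real.norm_of_nonneg Real.pi_pos.le, Complex.norm_ofNat]
    linarith [Real.pi_lt_four]
  refine ⟨fun m => m.factorial * PowerSeries.coeff m sechSer, ?_, fun k => ?_,
    poleFreePart (Complex.I * (Real.pi / 3)) * (Complex.I * (Real.pi / 3) * (Real.pi ^ 2 / 9))⁻¹,
    ?_, ?_⟩
  · rw [IsStrangeMoments, ← sechSer_mul]
    congr 1
    ext m
    rw [PowerSeries.coeff_mk, mul_div_cancel_left₀ _ (hfac m)]
  · simp only [coeff_sechSer_even, mul_zero]
  · exact mul_ne_zero poleFreePart_pole_ne_zero (inv_ne_zero (mul_ne_zero hz (by simp [hpi])))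
  · have h1 := (Complex.hasSum_taylorSeries_on_ball differentiableOn_poleFreePart
      hmem).tendsto_sum_nat
    have h2 : Filter.Tendsto (fun k : ℕ => 2 * (k + 1)) Filter.atTop Filter.atTop :=
      Filter.tendsto_atTop_mono (fun k => by simp; omega) Filter.tendsto_id
    refine ((h1.comp h2).mul_const
      (Complex.I * (Real.pi / 3) * (Real.pi ^ 2 / 9))⁻¹).congr fun k => ?_
    have h3 := sum_coeff_taylorSer_poleFreePart k
    simp only [Function.comp_apply]
    have h4 : ∑ n ∈ Finset.range (2 * (k + 1)), ((n.factorial : ℂ))⁻¹ •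
        (Complex.I * (Real.pi / 3) - 0) ^ n • iteratedDeriv n poleFreePart 0 =
        ∑ n ∈ Finset.range (2 * (k + 1)),
        PowerSeries.coeff n (taylorSer poleFreePart) * (Complex.I * (Real.pi / 3)) ^ n := by
      refine Finset.sum_congr rfl fun n _ => ?_
      rw [taylorSer, PowerSeries.coeff_mk, smul_eq_mul, smul_eq_mul, sub_zero]
      ring
    rw [h4, h3, mul_div_cancel_left₀ _ (hfac _)]
    have hI := Complex.I_ne_zero
    field_simp
    ring

end MomentSeriesExistence

section MomentAsymptotics

theorem tendsto_sum_range_of_dominated {E : Type*} [NormedAddCommGroup E] [CompleteSpace E]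
    {f : ℕ → ℕ → E} {L : ℕ → E} {bound : ℕ → ℝ} (hb : Summable bound)
    (hle : ∀ n j, j ≤ n → ‖f n j‖ ≤ bound j)
    (hlim : ∀ j, Filter.Tendsto (fun n => f n j) Filter.atTop (nhds (L j))) :
    Filter.Tendsto (fun n => ∑ j ∈ Finset.range (n + 1), f n j) Filter.atTop
      (nhds (∑' j, L j)) := by
  have hb0 : ∀ j, 0 ≤ bound j := fun j => (norm_nonneg _).trans (hle j j le_rfl)
  have h := tendsto_tsum_of_dominated_convergence (𝓕 := Filter.atTop)
    (f := fun n j => if j ≤ n then f n j else 0) (g := L) hb (fun j => ?_)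
    (Filter.Eventually.of_forall fun n j => ?_)
  · refine h.congr fun n => ?_
    rw [tsum_eq_sum (s := Finset.range (n + 1))]
    · refine Finset.sum_congr rfl fun j hj => ?_
      rw [Finset.mem_range] at hj
      rw [if_pos (by omega)]
    · intro j hj
      rw [Finset.mem_range] at hj
      rw [if_neg (by omega)]
  · refine (hlim j).congr' ?_
    filter_upwards [Filter.eventually_ge_atTop j] with n hn
    rw [if_pos hn]
  · split_ifs with hj
    · exact hle n j hj
    · simpa using hb0 j

open Polynomial in
theorem momentMap_heatPoly_pow {ν : ℕ → ℂ} (hν : ∀ k, ν (2 * k) = 0) (n : ℕ) :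
    momentMap ℂ ν (heatPoly ^ n * (X + C (1 / 2))) =
      (1 / 6) ^ n * ∑ j ∈ Finset.range (n + 1),
        (1 / 4) ^ j * (n.choose j : ℂ) * ((-1) ^ (n - j) * ν (2 * (n - j) + 1)) := by
  have e1 : heatPoly ^ n * (X + C (1 / 2)) = C ((1 / 6) ^ n) * ∑ j ∈ Finset.range (n + 1),
      (C ((1 / 4) ^ j * (n.choose j : ℂ) * (-1) ^ (n - j)) * X ^ (2 * (n - j) + 1) +
        C ((1 / 4) ^ j * (n.choose j : ℂ) * (-1) ^ (n - j) * (1 / 2)) * X ^ (2 * (n - j))) := by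
    have : heatPoly = C (1 / 6) * (C (1 / 4) + -X ^ 2) := by
      rw [heatPoly, show (-1 / 6 : ℂ) = -(1 / 6) by ring, C_neg]; ring
    rw [this, mul_pow, add_pow, ← C_pow, mul_assoc, Finset.sum_mul]
    congr 1
    refine Finset.sum_congr rfl fun j _ => ?_
    rw [neg_pow, ← pow_mul]
    simp only [map_mul, map_pow, map_natCast, map_neg, map_one]
    ring
  rw [e1, momentMap_C_mul, map_sum]
  congr 1
  refine Finset.sum_congr rfl fun j _ => ?_
  rw [map_add, momentMap_C_mul, momentMap_C_mul, momentMap_X_pow, momentMap_X_pow, hν]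
  simp only [Algebra.algebraMap_self, RingHom.id_apply]
  ring

theorem choose_mul_factorial_succ {n j : ℕ} (hj : j < n) :
    2 * (j + 1) * (2 * (n - j) + 1) *
      (n.choose (j + 1) * (2 * (n - (j + 1)) + 1).factorial) =
      n.choose j * (2 * (n - j) + 1).factorial := by
  obtain ⟨d, rfl⟩ : ∃ d, n = j + 1 + d := ⟨n - (j + 1), by omega⟩
  have h1 : j + 1 + d - j = d + 1 := by omega
  have h2 : j + 1 + d - (j + 1) = d := by omega
  have h3 := Nat.choose_succ_right_eq (j + 1 + d) j
  rw [h1] at h3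
  rw [h1, h2, show 2 * (d + 1) + 1 = 2 * d + 1 + 1 + 1 by ring, Nat.factorial_succ (2 * d + 1 + 1),
    Nat.factorial_succ (2 * d + 1)]
  calc _ = 2 * (2 * d + 1 + 1 + 1) * (((j + 1 + d).choose (j + 1) * (j + 1)) *
      (2 * d + 1).factorial) := by ring
    _ = _ := by rw [h3]; ring

theorem factorial_mul_choose_mul_factorial_le {n j : ℕ} (hj : j ≤ n) :
    j.factorial * (n.choose j * (2 * (n - j) + 1).factorial) ≤ (2 * n + 1).factorial := by
  induction j with
  | zero => simp
  | succ j ih =>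
    refine le_trans ?_ (ih (by omega))
    rw [← choose_mul_factorial_succ (by omega : j < n), Nat.factorial_succ]
    have : (j + 1) ≤ 2 * (j + 1) * (2 * (n - j) + 1) := by nlinarith
    calc _ = j.factorial * ((j + 1) * (n.choose (j + 1) * (2 * (n - (j + 1)) + 1).factorial)) := by
          ring
      _ ≤ _ := Nat.mul_le_mul_left _ (Nat.mul_le_mul_right _ this)

theorem sub_mul_choose_mul_factorial_le {n j : ℕ} (hj : j < n) :
    (n - j) * (n.choose (j + 1) * (2 * (n - (j + 1)) + 1).factorial) ≤ (2 * n + 1).factorial := by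
  refine le_trans ?_ (factorial_mul_choose_mul_factorial_le hj.le)
  rw [← choose_mul_factorial_succ hj]
  have h1 : (n - j) ≤ 2 * (j + 1) * (2 * (n - j) + 1) := by nlinarith
  have h2 := Nat.mul_le_mul_right (n.choose (j + 1) * (2 * (n - (j + 1)) + 1).factorial) h1
  exact h2.trans (Nat.le_mul_of_pos_left _ j.factorial_pos)

theorem tendsto_choose_mul_factorial_div (j : ℕ) :
    Filter.Tendsto (fun n : ℕ => ((n.choose j : ℝ) * (2 * (n - j) + 1).factorial) /
      (2 * n + 1).factorial) Filter.atTop (nhds (if j = 0 then 1 else 0)) := by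
  cases j with
  | zero =>
    refine tendsto_const_nhds.congr fun n => ?_
    have : ((2 * n + 1).factorial : ℝ) ≠ 0 := by exact_mod_cast Nat.factorial_ne_zero _
    simp [this]
  | succ j =>
    rw [if_neg (by omega)]
    have hlim : Filter.Tendsto (fun n : ℕ => (1 : ℝ) / ((n - j : ℕ) : ℝ)) Filter.atTop (nhds 0) :=
      tendsto_one_div_atTop_nhds_zero_nat.comp (Filter.tendsto_sub_atTop_nat j)
    refine squeeze_zero' (Filter.Eventually.of_forall fun n => by positivity) ?_ hlim
    filter_upwards [Filter.eventually_gt_atTop j] with n hn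
    have h1 : (((n - j) * (n.choose (j + 1) * (2 * (n - (j + 1)) + 1).factorial) : ℕ) : ℝ) ≤
        ((2 * n + 1).factorial : ℕ) := by exact_mod_cast sub_mul_choose_mul_factorial_le hn
    have h2 : (0 : ℝ) < ((n - j : ℕ) : ℝ) := by exact_mod_cast Nat.sub_pos_of_lt hn
    rw [div_le_div_iff₀ (by positivity) h2]
    push_cast at h1 ⊢
    linarith

theorem tendsto_momentMap_heatPoly_pow {ν : ℕ → ℂ} {ρ c : ℂ} (hν : ∀ k, ν (2 * k) = 0)
    (hρ : ρ ≠ 0)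
    (hc : Filter.Tendsto (fun k : ℕ => (-1) ^ k * (ν (2 * k + 1) / (2 * k + 1).factorial) * ρ ^ k)
      Filter.atTop (nhds c)) :
    Filter.Tendsto (fun n : ℕ => momentMap ℂ ν
      (heatPoly ^ n * (Polynomial.X + Polynomial.C (1 / 2))) * (6 * ρ) ^ n / (2 * n + 1).factorial)
      Filter.atTop (nhds c) := by
  have hfac : ∀ m : ℕ, (m.factorial : ℂ) ≠ 0 := fun m => by exact_mod_cast m.factorial_ne_zero
  set g : ℕ → ℂ := fun k => (-1) ^ k * (ν (2 * k + 1) / (2 * k + 1).factorial) * ρ ^ k with hg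
  obtain ⟨G, hG⟩ := hc.norm.bddAbove_range
  have hG' : ∀ k, ‖g k‖ ≤ G := fun k => hG ⟨k, rfl⟩
  have hG0 : 0 ≤ G := (norm_nonneg _).trans (hG' 0)
  have key := tendsto_sum_range_of_dominated
    (f := fun n j => (ρ / 4) ^ j * ((((n.choose j : ℝ) * (2 * (n - j) + 1).factorial) /
      (2 * n + 1).factorial : ℝ) : ℂ) * g (n - j))
    (L := fun j => (ρ / 4) ^ j * ((if j = 0 then 1 else 0 : ℝ) : ℂ) * c)
    (bound := fun j => ‖ρ / 4‖ ^ j / j.factorial * G)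
    ((Real.summable_pow_div_factorial _).mul_right _) ?_ ?_
  · rw [tsum_eq_single 0 (fun j hj => by simp [hj])] at key
    simp only [pow_zero, if_true, Complex.ofReal_one, one_mul] at key
    refine key.congr fun n => ?_
    rw [momentMap_heatPoly_pow hν, mul_pow, mul_comm ((1 / 6 : ℂ) ^ n), mul_assoc, ← mul_assoc
      ((1 / 6 : ℂ) ^ n), ← mul_pow, show (1 / 6 * 6 : ℂ) = 1 by norm_num, one_pow, one_mul,
      Finset.sum_mul, Finset.sum_div]
    refine Finset.sum_congr rfl fun j hj => ?_
    rw [Finset.mem_range] at hj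
    have hn : ρ ^ n = ρ ^ j * ρ ^ (n - j) := by rw [← pow_add]; congr 1; omega
    have h1 := hfac (2 * (n - j) + 1)
    have h2 := hfac (2 * n + 1)
    simp only [hg]
    rw [hn]
    push_cast
    rw [div_pow, div_pow]
    field_simp
    simp
  · intro n j hj
    rw [norm_mul, norm_mul, norm_pow, Complex.norm_real, Real.norm_of_nonneg (by positivity),
      div_eq_mul_one_div (‖ρ / 4‖ ^ j)]
    have h1 : ((j.factorial * (n.choose j * (2 * (n - j) + 1).factorial) : ℕ) : ℝ) ≤
        ((2 * n + 1).factorial : ℕ) := by exact_mod_cast factorial_mul_choose_mul_factorial_le hj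
    push_cast at h1
    gcongr ?_ * ?_ * ?_
    · rw [div_le_div_iff₀ (by positivity) (by positivity)]
      linarith
    · exact hG' _
  · intro j
    refine (tendsto_const_nhds.mul ?_).mul (hc.comp (Filter.tendsto_sub_atTop_nat j))
    exact (Complex.continuous_ofReal.tendsto _).comp (tendsto_choose_mul_factorial_div j)

theorem tendsto_sq_mul_div_of_momentMap {ν : ℕ → ℂ} {c : ℂ} (hν : ∀ k, ν (2 * k) = 0)
    (hc0 : c ≠ 0)
    (hc : Filter.Tendsto (fun k : ℕ => (-1) ^ k * (ν (2 * k + 1) / (2 * k + 1).factorial) *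
      (Real.pi ^ 2 / 9 : ℂ) ^ k) Filter.atTop (nhds c)) {l : ℕ → ℝ} (hpos : ∀ n, 0 < l n)
    (hl : ∀ n, (l n : ℂ) = momentMap ℂ ν
      (heatPoly ^ n * (Polynomial.X + Polynomial.C (1 / 2)))) :
    Filter.Tendsto (fun n : ℕ => ((n : ℝ) + 1) ^ 2 * l n / l (n + 1)) Filter.atTop
      (nhds (Real.pi ^ 2 / 6)) := by
  have hpi : (Real.pi : ℂ) ≠ 0 := by exact_mod_cast Real.pi_ne_zero
  have hρ : (Real.pi ^ 2 / 9 : ℂ) ≠ 0 := by simp [hpi]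
  have h1 := tendsto_momentMap_heatPoly_pow hν hρ hc
  have h2 := (h1.div (h1.comp (Filter.tendsto_add_atTop_nat 1)) hc0)
  rw [div_self hc0] at h2
  have h3 : Filter.Tendsto (fun n : ℕ => ((Real.pi ^ 2 / 6 * (1 - 1 / (2 * (n : ℝ) + 3)) : ℝ) : ℂ))
      Filter.atTop (nhds ((Real.pi ^ 2 / 6 * (1 - 0) : ℝ) : ℂ)) := by
    refine (Complex.continuous_ofReal.tendsto _).comp (tendsto_const_nhds.mul
      (tendsto_const_nhds.sub ?_))
    refine tendsto_const_nhds.div_atTop (Filter.tendsto_atTop_add_const_right _ _ ?_)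
    exact tendsto_natCast_atTop_atTop.const_mul_atTop two_pos
  have h4 := h2.mul h3
  rw [sub_zero, mul_one, one_mul] at h4
  rw [← Filter.tendsto_ofReal_iff]
  refine h4.congr fun n => ?_
  have hl0 : (l n : ℂ) ≠ 0 := by exact_mod_cast (hpos n).ne'
  have hl1 : (l (n + 1) : ℂ) ≠ 0 := by exact_mod_cast (hpos (n + 1)).ne'
  have h5 : ((2 * n + 1).factorial : ℂ) ≠ 0 := by exact_mod_cast Nat.factorial_ne_zero _
  have h6 : (2 * (n : ℂ) + 3) ≠ 0 := by exact_mod_cast Nat.succ_ne_zero (2 * n + 2)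
  have h7 : (n : ℂ) + 1 ≠ 0 := by exact_mod_cast Nat.succ_ne_zero n
  simp only [Pi.div_apply, Function.comp_apply]
  rw [← hl, ← hl, show 2 * (n + 1) + 1 = 2 * n + 1 + 1 + 1 by ring, Nat.factorial_succ (2 * n + 1 + 1),
    Nat.factorial_succ (2 * n + 1), pow_succ]
  push_cast
  have h8 : (2 * (n : ℂ) + 1 + 1 + 1) = 2 * n + 3 := by ring
  rw [h8]
  field_simp
  ring

end MomentAsymptotics

section IntervalRepresentation

/-- A finite set of pairs `(l, r)` is a canonical set of intervals if `l ≤ r` for each of them, and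
the left and the right endpoints both fill an initial segment `{0, …, k - 1}`. -/
def IsCanonical (C : Finset (ℕ × ℕ)) : Prop :=
  (∀ p ∈ C, p.1 ≤ p.2) ∧
    ∃ k, C.image Prod.fst = Finset.range k ∧ C.image Prod.snd = Finset.range k

/-- Families of intervals indexed by `Fin n` whose set of values is canonical. -/
abbrev CanonicalMap (n : ℕ) : Type :=
  {w : Fin n → ℕ × ℕ // IsCanonical (Finset.univ.image w)}

theorem isCanonical_image_iff {n : ℕ} {w : Fin n → ℕ × ℕ} :
    IsCanonical (Finset.univ.image w) ↔ (∀ x, (w x).1 ≤ (w x).2) ∧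
      ∃ k, (∀ x, (w x).2 < k) ∧ ∀ j < k, (∃ x, (w x).1 = j) ∧ ∃ x, (w x).2 = j := by
  constructor
  · rintro ⟨h1, k, hl, hr⟩
    have h1' : ∀ x, (w x).1 ≤ (w x).2 := fun x => h1 _ (Finset.mem_image_of_mem _ (Finset.mem_univ x))
    refine ⟨h1', k, fun x => ?_, fun j hj => ⟨?_, ?_⟩⟩
    · rw [← Finset.mem_range, ← hr]
      exact Finset.mem_image_of_mem _ (Finset.mem_image_of_mem _ (Finset.mem_univ x))
    · rw [← Finset.mem_range, ← hl] at hj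
      simpa using hj
    · rw [← Finset.mem_range, ← hr] at hj
      simpa using hj
  · rintro ⟨h1, k, hk, hs⟩
    refine ⟨by simpa using h1, k, ?_, ?_⟩
    · ext j
      rw [Finset.mem_range]
      constructor
      · intro h
        obtain ⟨x, hx⟩ : ∃ x, (w x).1 = j := by simpa using h
        exact hx ▸ (h1 x).trans_lt (hk x)
      · intro h
        simpa using (hs j h).1
    · ext j
      rw [Finset.mem_range]
      constructor
      · intro h
        obtain ⟨x, hx⟩ : ∃ x, (w x).2 = j := by simpa using h
        exact hx ▸ hk x
      · intro h
        simpa using (hs j h).2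

/-- The interval order of a canonical family of intervals. -/
def CanonicalMap.toRel {n : ℕ} (w : CanonicalMap n) : IntervalOrderRel n :=
  ⟨fun x y => (w.1 x).2 < (w.1 y).1, by
    have h := (isCanonical_image_iff.mp w.2).1
    refine ⟨{ irrefl := fun x hx => ?_, trans := fun x y z hxy hyz => ?_ }, fun a b c d h1 h2 => ?_⟩
    · exact absurd (h x) (not_le.mpr hx)
    · exact hxy.trans_le ((h y).trans hyz.le)
    · by_contra! h3
      omega⟩

theorem CanonicalMap.fst_le_of_toRel_eq {n : ℕ} {w w' : CanonicalMap n} (h : w.toRel = w'.toRel)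
    (m : ℕ) : ∀ y, (w.1 y).1 = m → m ≤ (w'.1 y).1 := by
  have hrel : ∀ x y, (w.1 x).2 < (w.1 y).1 ↔ (w'.1 x).2 < (w'.1 y).1 := fun x y =>
    iff_of_eq (congrFun (congrFun (congrArg Subtype.val h) x) y)
  obtain ⟨h1, k, hk, hs⟩ := isCanonical_image_iff.mp w.2
  induction m with
  | zero => intro y _; exact Nat.zero_le _
  | succ m ih =>
    intro y hy
    have hm : m < k := by have := h1 y; have := hk y; omega
    obtain ⟨⟨x, hx⟩, z, hz⟩ := hs m hm
    have hzy := (hrel z y).mp (by omega)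
    have hzx := (hrel z x).not.mp (by omega)
    have := ih x hx
    omega

theorem CanonicalMap.fst_eq_of_toRel_eq {n : ℕ} {w w' : CanonicalMap n} (h : w.toRel = w'.toRel)
    (y : Fin n) : (w.1 y).1 = (w'.1 y).1 :=
  le_antisymm (fst_le_of_toRel_eq h _ y rfl) (fst_le_of_toRel_eq h.symm _ y rfl)

theorem CanonicalMap.snd_le_of_toRel_eq {n : ℕ} {w w' : CanonicalMap n} (h : w.toRel = w'.toRel)
    (x : Fin n) : (w.1 x).2 ≤ (w'.1 x).2 := by
  have hrel : ∀ x y, (w.1 x).2 < (w.1 y).1 ↔ (w'.1 x).2 < (w'.1 y).1 := fun x y =>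
    iff_of_eq (congrFun (congrFun (congrArg Subtype.val h) x) y)
  obtain ⟨h1, k, hk, hs⟩ := isCanonical_image_iff.mp w.2
  obtain ⟨⟨y, hy⟩, -⟩ := hs _ (hk x)
  have h2 := (hrel x y).not.mp (by omega)
  have h3 := fst_eq_of_toRel_eq h y
  omega

theorem CanonicalMap.toRel_injective (n : ℕ) :
    Function.Injective (CanonicalMap.toRel (n := n)) := fun _ _ h =>
  Subtype.ext (funext fun x => Prod.ext (fst_eq_of_toRel_eq h x)
    (le_antisymm (snd_le_of_toRel_eq h x) (snd_le_of_toRel_eq h.symm x)))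

theorem CanonicalMap.toRel_surjective (n : ℕ) :
    Function.Surjective (CanonicalMap.toRel (n := n)) := by
  rintro ⟨r, hr, h22⟩
  set D : Fin n → Finset (Fin n) := fun y => Finset.univ.filter fun x => r x y with hD
  have memD : ∀ x y, x ∈ D y ↔ r x y := fun x y => by simp [hD]
  set 𝒟 := Finset.univ.image D with h𝒟
  have hDmem : ∀ y, D y ∈ 𝒟 := fun y => Finset.mem_image_of_mem _ (Finset.mem_univ y)
  have htot : ∀ S ∈ 𝒟, ∀ T ∈ 𝒟, S ⊆ T ∨ T ⊂ S := by
    intro S hS T hT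
    obtain ⟨b, -, rfl⟩ := Finset.mem_image.mp hS
    obtain ⟨d, -, rfl⟩ := Finset.mem_image.mp hT
    by_cases hsub : D b ⊆ D d
    · exact Or.inl hsub
    · obtain ⟨a, hab, had⟩ := Finset.not_subset.mp hsub
      rw [memD] at hab had
      refine Or.inr (lt_of_le_not_ge (fun c hc => ?_) hsub)
      rw [memD] at hc ⊢
      exact (h22 a b c d hab hc).resolve_left had
  set rank : Finset (Fin n) → ℕ := fun S => (𝒟.filter fun T => T ⊂ S).card with hrank
  have rank_lt : ∀ S ∈ 𝒟, ∀ T, S ⊂ T → rank S < rank T := by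
    intro S hS T hST
    refine Finset.card_lt_card (Finset.ssubset_iff_of_subset ?_ |>.mpr ⟨S, ?_, ?_⟩)
    · exact Finset.monotone_filter_right _ fun U _ hU => (show U ⊂ S from hU).trans hST
    · simp [hS, hST]
    · simp
  have rank_lt_card : ∀ S ∈ 𝒟, rank S < 𝒟.card := fun S hS =>
    Finset.card_lt_card (Finset.filter_ssubset.mpr ⟨S, hS, by simp⟩)
  have card_le : ∀ S ∈ 𝒟, (𝒟.filter fun T => T ⊆ S).card = rank S + 1 := by
    intro S hS
    have : (𝒟.filter fun T => T ⊆ S) = insert S (𝒟.filter fun T => T ⊂ S) := by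
      ext T
      rw [Finset.mem_insert, Finset.mem_filter, Finset.mem_filter, subset_iff_ssubset_or_eq]
      constructor
      · rintro ⟨h1, h2 | h2⟩
        · exact Or.inr ⟨h1, h2⟩
        · exact Or.inl h2
      · rintro (h1 | h1)
        · exact ⟨h1 ▸ hS, Or.inr h1⟩
        · exact ⟨h1.1, Or.inl h1.2⟩
    rw [this, Finset.card_insert_of_notMem (by simp)]
  have rank_image : 𝒟.image rank = Finset.range 𝒟.card := by
    refine Finset.eq_of_subset_of_card_le ?_ ?_
    · intro j hj
      obtain ⟨S, hS, rfl⟩ := Finset.mem_image.mp hj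
      exact Finset.mem_range.mpr (rank_lt_card S hS)
    · refine (Finset.card_range _).trans_le (Finset.card_image_of_injOn ?_).ge
      intro S hS T hT hST
      rcases htot S hS T hT with h | h
      · rcases subset_iff_ssubset_or_eq.mp h with h | h
        · exact absurd hST (rank_lt S hS T h).ne
        · exact h
      · exact absurd hST (rank_lt T hT S h).ne'
  set R : Fin n → ℕ := fun x => (𝒟.filter fun S => x ∉ S).card - 1 with hR
  have self_notMem : ∀ x, x ∉ D x := fun x => by rw [memD]; exact hr.irrefl x
  have hR1 : ∀ x, R x + 1 = (𝒟.filter fun S => x ∉ S).card := fun x =>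
    Nat.sub_add_cancel (Finset.card_pos.mpr ⟨D x, by simp [hDmem, self_notMem]⟩)
  have hrel : ∀ x y, R x < rank (D y) ↔ r x y := by
    intro x y
    constructor
    · intro h
      by_contra hxy
      have : rank (D y) + 1 ≤ R x + 1 := by
        rw [hR1, ← card_le _ (hDmem y)]
        refine Finset.card_le_card (Finset.monotone_filter_right _ fun U _ hU hx => hxy ?_)
        exact (memD x y).mp ((show U ⊆ D y from hU) hx)
      omega
    · intro h
      rw [← Nat.succ_le_iff, Nat.succ_eq_add_one, hR1]
      refine Finset.card_le_card fun U hU => ?_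
      rw [Finset.mem_filter] at hU ⊢
      refine ⟨hU.1, (htot _ (hDmem y) _ hU.1).resolve_left fun hs => hU.2 (hs ((memD x y).mpr h))⟩
  have hcan : IsCanonical (Finset.univ.image fun x => (rank (D x), R x)) := by
    rw [isCanonical_image_iff]
    refine ⟨fun x => not_lt.mp ((hrel x x).not.mpr (hr.irrefl x)), 𝒟.card, fun x => ?_,
      fun j hj => ?_⟩
    · have := hR1 x
      have := Finset.card_filter_le 𝒟 (fun S => x ∉ S)
      simp only
      omega
    · have hex : ∀ i < 𝒟.card, ∃ S ∈ 𝒟, rank S = i := fun i hi => by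
        rw [← Finset.mem_range, ← rank_image] at hi
        simpa using hi
      obtain ⟨S, hS, hSj⟩ := hex j hj
      obtain ⟨y, -, rfl⟩ := Finset.mem_image.mp hS
      refine ⟨⟨y, hSj⟩, ?_⟩
      suffices h : ∃ x, ∀ U ∈ 𝒟, x ∉ U ↔ U ⊆ D y by
        obtain ⟨x, hx⟩ := h
        refine ⟨x, ?_⟩
        have h1 := hR1 x
        rw [Finset.filter_congr hx, card_le _ hS] at h1
        simp only
        omega
      by_cases hj' : j + 1 < 𝒟.card
      · obtain ⟨S', hS', hSj'⟩ := hex (j + 1) hj'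
        have hss : D y ⊂ S' := by
          refine (htot _ hS' _ hS).resolve_left fun h => ?_
          rcases subset_iff_ssubset_or_eq.mp h with h | h
          · have := rank_lt _ hS' _ h; omega
          · rw [h] at hSj'; omega
        obtain ⟨x, hxS', hxy⟩ := Finset.exists_of_ssubset hss
        refine ⟨x, fun U hU => ⟨fun hxU => ?_, fun hU hx => hxy (hU hx)⟩⟩
        have h1 : U ⊂ S' := (htot _ hS' _ hU).resolve_left fun h => hxU (h hxS')
        have h2 := rank_lt _ hU _ h1
        refine (htot _ hU _ hS).resolve_right fun h => ?_
        have := rank_lt _ hS _ h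
        omega
      · refine ⟨y, fun U hU => ⟨fun _ => (htot _ hU _ hS).resolve_right fun h => ?_,
          fun hU hx => self_notMem y (hU hx)⟩⟩
        have := rank_lt _ hS _ h
        have := rank_lt_card _ hU
        omega
  refine ⟨⟨_, hcan⟩, Subtype.ext (funext fun x => funext fun y => propext ?_)⟩
  exact hrel x y

/-- Interval orders correspond to canonical families of intervals. -/
noncomputable def CanonicalMap.equivRel (n : ℕ) : CanonicalMap n ≃ IntervalOrderRel n :=
  Equiv.ofBijective _ ⟨CanonicalMap.toRel_injective n, CanonicalMap.toRel_surjective n⟩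

theorem CanonicalMap.dupHoldings_equivRel {n : ℕ} (w : CanonicalMap n) (x y : Fin n) :
    DupHoldings (equivRel n w) x y ↔ x ≠ y ∧ w.1 x = w.1 y := by
  obtain ⟨h1, k, hk, hs⟩ := isCanonical_image_iff.mp w.2
  have hrel : ∀ a b, (equivRel n w).1 a b ↔ (w.1 a).2 < (w.1 b).1 := fun a b => Iff.rfl
  simp only [DupHoldings, hrel]
  refine and_congr_right fun _ => ⟨fun ⟨hd, hu⟩ => ?_, fun h => by simp [h]⟩
  have hx := h1 x
  have hy := h1 y
  have hkx := hk x
  have hky := hk y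
  obtain ⟨-, z1, hz1⟩ := hs (w.1 x).1 (by omega)
  obtain ⟨-, z2, hz2⟩ := hs (w.1 y).1 (by omega)
  obtain ⟨⟨z3, hz3⟩, -⟩ := hs (w.1 x).2 (by omega)
  obtain ⟨⟨z4, hz4⟩, -⟩ := hs (w.1 y).2 (by omega)
  have := hd z1
  have := hd z2
  have := hu z3
  have := hu z4
  exact Prod.ext (by omega) (by omega)

instance (n : ℕ) : Finite (IntervalOrderRel n) := by
  unfold IntervalOrderRel
  infer_instance

instance (n : ℕ) : Finite (CanonicalMap n) :=
  Finite.of_equiv _ (CanonicalMap.equivRel n).symm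

theorem labelledIntervalOrderCount_eq_card_canonicalMap (n : ℕ) :
    labelledIntervalOrderCount n = Nat.card (CanonicalMap n) :=
  (Nat.card_congr (CanonicalMap.equivRel n)).symm

end IntervalRepresentation

section Counting

/-- The integer intervals `(l, r)` with `l ≤ r < k`. -/
def intervalsBelow (k : ℕ) : Finset (ℕ × ℕ) :=
  (Finset.range k ×ˢ Finset.range k).filter fun p => p.1 ≤ p.2

/-- The maps from `Fin n` to intervals below `k` that hit all left and all right endpoints. -/
noncomputable def ontoIntervals (n k : ℕ) : Finset (Fin n → ℕ × ℕ) :=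
  (Fintype.piFinset fun _ => intervalsBelow k).filter fun w =>
    (∀ j ∈ Finset.range k, ∃ x, (w x).1 = j) ∧ ∀ j ∈ Finset.range k, ∃ x, (w x).2 = j

theorem ite_forall_exists_eq_sum {ι : Type*} (f : ι → ℕ) (s : Finset ℕ)
    [Decidable (∀ j ∈ s, ∃ x, f x = j)] :
    (if ∀ j ∈ s, ∃ x, f x = j then 1 else 0 : ℂ) =
      ∑ B ∈ s.powerset, (-1) ^ B.card * (if ∀ x, f x ∉ B then 1 else 0) := by
  have h1 : (if ∀ j ∈ s, ∃ x, f x = j then 1 else 0 : ℂ) =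
      ∏ j ∈ s, (-(if ∀ x, f x ≠ j then 1 else 0) + 1) := by
    trans ∏ j ∈ s, (if ∃ x, f x = j then 1 else 0)
    · by_cases h : ∀ j ∈ s, ∃ x, f x = j
      · rw [if_pos h]
        exact (Finset.prod_eq_one fun j hj => if_pos (h j hj)).symm
      · rw [if_neg h]
        push Not at h
        obtain ⟨j, hj, hne⟩ := h
        exact (Finset.prod_eq_zero hj (if_neg fun ⟨x, hx⟩ => hne x hx)).symm
    refine Finset.prod_congr rfl fun j _ => ?_
    by_cases h : ∃ x, f x = j
    · rw [if_pos h, if_neg (by push Not; exact h)]; simp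
    · rw [if_neg h, if_pos (by push Not at h; exact h)]; simp
  rw [h1, Finset.prod_add]
  refine Finset.sum_congr rfl fun B _ => ?_
  rw [Finset.prod_const_one, mul_one, Finset.prod_neg, Finset.prod_ite_zero, Finset.prod_const_one]
  congr 1
  refine if_congr ⟨fun h x hx => h _ hx x rfl, fun h j hj x hx => h x (hx ▸ hj)⟩ rfl rfl

theorem card_ontoIntervals (n k : ℕ) :
    ((ontoIntervals n k).card : ℂ) =
      ∑ B ∈ (Finset.range k).powerset, ∑ A ∈ (Finset.range k).powerset,
        (-1) ^ B.card * (-1) ^ A.card *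
          (((intervalsBelow k).filter fun p => p.1 ∉ B ∧ p.2 ∉ A).card : ℂ) ^ n := by
  have h1 : ((ontoIntervals n k).card : ℂ) = ∑ w ∈ Fintype.piFinset fun _ : Fin n => intervalsBelow k,
      (if ∀ j ∈ Finset.range k, ∃ x, (w x).1 = j then 1 else 0 : ℂ) *
        (if ∀ j ∈ Finset.range k, ∃ x, (w x).2 = j then 1 else 0 : ℂ) := by
    rw [ontoIntervals, Finset.card_filter, Nat.cast_sum]
    refine Finset.sum_congr rfl fun w _ => ?_
    rw [ite_and]
    split_ifs <;> simp
  have h2 : ∀ w : Fin n → ℕ × ℕ,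
      (if ∀ j ∈ Finset.range k, ∃ x, (w x).1 = j then 1 else 0 : ℂ) *
        (if ∀ j ∈ Finset.range k, ∃ x, (w x).2 = j then 1 else 0 : ℂ) =
      ∑ B ∈ (Finset.range k).powerset, ∑ A ∈ (Finset.range k).powerset,
        (-1) ^ B.card * (-1) ^ A.card * (if ∀ x, (w x).1 ∉ B ∧ (w x).2 ∉ A then 1 else 0) := by
    intro w
    rw [ite_forall_exists_eq_sum (fun x => (w x).1), ite_forall_exists_eq_sum (fun x => (w x).2),
      Finset.sum_mul_sum]
    refine Finset.sum_congr rfl fun B _ => Finset.sum_congr rfl fun A _ => ?_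
    simp only [forall_and]
    by_cases hB : ∀ x, (w x).1 ∉ B <;> by_cases hA : ∀ x, (w x).2 ∉ A <;> simp [hA, hB]
  rw [h1, Finset.sum_congr rfl fun w _ => h2 w, Finset.sum_comm]
  refine Finset.sum_congr rfl fun B _ => ?_
  rw [Finset.sum_comm]
  refine Finset.sum_congr rfl fun A _ => ?_
  rw [← Finset.mul_sum]
  congr 1
  rw [Finset.sum_boole, ← Nat.cast_pow]
  congr 1
  have h3 : ((Fintype.piFinset fun _ : Fin n => intervalsBelow k).filter
      fun w => ∀ x, (w x).1 ∉ B ∧ (w x).2 ∉ A) =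
      Fintype.piFinset fun _ : Fin n => (intervalsBelow k).filter fun p => p.1 ∉ B ∧ p.2 ∉ A := by
    ext w
    simp only [Finset.mem_filter, Fintype.mem_piFinset, forall_and]
  rw [h3, Fintype.card_piFinset_const]

theorem card_intervalsBelow_filter (k : ℕ) (A B : Finset ℕ) :
    ((intervalsBelow k).filter fun p => p.1 ∉ B ∧ p.2 ∉ A).card =
      ∑ r ∈ Finset.range k \ A, (Finset.range (r + 1) \ B).card := by
  rw [Finset.card_eq_sum_card_fiberwise (f := Prod.snd) (t := Finset.range k \ A)]
  · refine Finset.sum_congr rfl fun r hr => ?_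
    rw [Finset.mem_sdiff, Finset.mem_range] at hr
    rw [← Finset.card_image_of_injective (Finset.range (r + 1) \ B) (f := fun l => (l, r))
      fun a b h => (Prod.ext_iff.mp h).1]
    congr 1
    ext ⟨l, r'⟩
    simp only [intervalsBelow, Finset.mem_filter, Finset.mem_product, Finset.mem_range,
      Finset.mem_image, Finset.mem_sdiff, Prod.mk.injEq]
    constructor
    · rintro ⟨⟨⟨⟨h1, h2⟩, h3⟩, h4, h5⟩, h6⟩
      exact ⟨l, ⟨by omega, h4⟩, rfl, h6.symm⟩
    · rintro ⟨l, ⟨h1, h2⟩, rfl, rfl⟩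
      exact ⟨⟨⟨⟨by omega, hr.1⟩, by omega⟩, h2, hr.2⟩, rfl⟩
  · intro p hp
    simp only [intervalsBelow, Finset.coe_filter, Finset.mem_filter, Finset.mem_product,
      Set.mem_ofPred_eq, Finset.mem_range] at hp
    simp [hp.1.1.2, hp.2.2]

theorem prod_expSer {ι : Type*} (s : Finset ι) (c : ι → ℕ) :
    ∏ r ∈ s, expSer ((c r : ℕ) : ℂ) = expSer ((∑ r ∈ s, c r : ℕ) : ℂ) := by
  induction s using Finset.induction_on with
  | empty => simp
  | insert a s ha ih => rw [Finset.prod_insert ha, Finset.sum_insert ha, ih, Nat.cast_add, expSer_add]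

theorem factorial_mul_coeff_columnSum (n k : ℕ) :
    (n.factorial : ℂ) * PowerSeries.coeff n (columnSum (fun c => expSer (c : ℂ)) k 1) =
      (ontoIntervals n k).card := by
  have hfac : (n.factorial : ℂ) ≠ 0 := by exact_mod_cast n.factorial_ne_zero
  rw [card_ontoIntervals, columnSum, map_sum, Finset.mul_sum]
  refine Finset.sum_congr rfl fun B _ => ?_
  have h1 : (-1) ^ B.card * (∏ r ∈ Finset.range k,
      (expSer (((Finset.range (r + 1) \ B).card : ℕ) : ℂ) - 1)) *
        (1 : ℕ → PowerSeries ℂ) ((Finset.range k \ B).card) =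
      ∑ A ∈ (Finset.range k).powerset, PowerSeries.C ((-1) ^ B.card * (-1) ^ A.card : ℂ) *
        expSer ((((intervalsBelow k).filter fun p => p.1 ∉ B ∧ p.2 ∉ A).card : ℕ) : ℂ) := by
    have h2 : ∀ r, (expSer (((Finset.range (r + 1) \ B).card : ℕ) : ℂ) - 1) =
      -1 + expSer (((Finset.range (r + 1) \ B).card : ℕ) : ℂ) := fun r => by ring
    rw [Finset.prod_congr rfl fun r _ => h2 r, Finset.prod_add, Pi.one_apply, mul_one,
      Finset.mul_sum]
    refine Finset.sum_congr rfl fun A _ => ?_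
    rw [Finset.prod_const, prod_expSer, card_intervalsBelow_filter, ← mul_assoc]
    simp
  rw [h1, map_sum, Finset.mul_sum]
  refine Finset.sum_congr rfl fun A _ => ?_
  rw [PowerSeries.coeff_C_mul, sum_expSer_coeff_complex]
  field_simp

theorem card_canonicalMap_eq_sum {n K : ℕ} (hK : n < K) :
    Nat.card (CanonicalMap n) = ∑ k ∈ Finset.range K, (ontoIntervals n k).card := by
  have key : ∀ w : Fin n → ℕ × ℕ, ∀ k, w ∈ ontoIntervals n k ↔ (∀ x, (w x).1 ≤ (w x).2) ∧
      (∀ x, (w x).2 < k) ∧ ∀ j < k, (∃ x, (w x).1 = j) ∧ ∃ x, (w x).2 = j := by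
    intro w k
    simp only [ontoIntervals, intervalsBelow, Finset.mem_filter, Fintype.mem_piFinset,
      Finset.mem_product, Finset.mem_range]
    constructor
    · rintro ⟨h1, h2, h3⟩
      exact ⟨fun x => (h1 x).2, fun x => (h1 x).1.2, fun j hj => ⟨h2 j hj, h3 j hj⟩⟩
    · rintro ⟨h1, h2, h3⟩
      exact ⟨fun x => ⟨⟨(h1 x).trans_lt (h2 x), h2 x⟩, h1 x⟩, fun j hj => (h3 j hj).1,
        fun j hj => (h3 j hj).2⟩
  have huniq : ∀ w : Fin n → ℕ × ℕ, ∀ k k', w ∈ ontoIntervals n k → w ∈ ontoIntervals n k' →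
      k ≤ k' := by
    intro w k k' h h'
    rw [key] at h h'
    by_contra! hlt
    obtain ⟨-, x, hx⟩ := h.2.2 k' hlt
    exact absurd (h'.2.1 x) (by omega)
  have hle : ∀ w : Fin n → ℕ × ℕ, ∀ k, w ∈ ontoIntervals n k → k ≤ n := by
    intro w k h
    rw [key] at h
    have h1 : Finset.range k ⊆ Finset.univ.image fun x => (w x).2 := fun j hj => by
      obtain ⟨-, x, hx⟩ := h.2.2 j (Finset.mem_range.mp hj)
      exact Finset.mem_image.mpr ⟨x, Finset.mem_univ x, hx⟩
    simpa using (Finset.card_le_card h1).trans Finset.card_image_le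
  rw [← Finset.card_biUnion]
  · rw [← Nat.card_eq_finsetCard]
    refine Nat.card_congr (Equiv.subtypeEquivRight fun w => ?_)
    rw [isCanonical_image_iff, Finset.mem_biUnion]
    constructor
    · rintro ⟨h1, k, h2⟩
      have hm := (key w k).mpr ⟨h1, h2⟩
      exact ⟨k, Finset.mem_range.mpr ((hle w k hm).trans_lt hK), hm⟩
    · rintro ⟨k, -, hm⟩
      rw [key] at hm
      exact ⟨hm.1, k, hm.2⟩
  · intro k _ k' _ hne
    rw [Function.onFun, Finset.disjoint_left]
    exact fun w h h' => hne (le_antisymm (huniq w k k' h h') (huniq w k' k h' h))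

theorem IsStrangeMoments.labelledIntervalOrderCount_eq {ν : ℕ → ℂ} (hν : IsStrangeMoments ν)
    (n : ℕ) :
    (labelledIntervalOrderCount n : ℂ) =
      momentMap ℂ ν (heatPoly ^ n * (Polynomial.X + Polynomial.C (1 / 2))) := by
  rw [← hν.coeff_sum_prod (K := n + 2) (by omega),
    labelledIntervalOrderCount_eq_card_canonicalMap,
    card_canonicalMap_eq_sum (by omega : n < n + 2), Nat.cast_sum]
  have h := pow_dvd_sum_columnSum_sub (Q := fun c => expSer (c : ℂ))
    (Q' := fun c => expSer (-(c : ℂ))) (x := PowerSeries.X)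
    (fun c => by rw [← dvd_neg, neg_sub]; exact X_dvd_one_sub_expSer _)
    (fun c => expSer_mul_neg _) (by simp) (n + 2)
  rw [PowerSeries.X_pow_dvd_iff] at h
  have h1 := h n (by omega)
  rw [map_sub, sub_eq_zero] at h1
  rw [← h1, map_sum, Finset.mul_sum]
  exact Finset.sum_congr rfl fun k _ => (factorial_mul_coeff_columnSum n k).symm

end Counting

section ImageSize

variable {α : Type*} [DecidableEq α]

instance finite_image_eq (n : ℕ) (C : Finset α) :
    Finite {w : Fin n → α // Finset.univ.image w = C} :=
  Finite.of_injective
    (fun w (x : Fin n) => (⟨w.1 x, by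
      have := Finset.mem_image_of_mem w.1 (Finset.mem_univ x)
      rwa [w.2] at this⟩ : C))
    fun w w' h => Subtype.ext (funext fun x => congrArg Subtype.val (congrFun h x))

theorem image_fin_cons {n : ℕ} (a : α) (w : Fin n → α) :
    Finset.univ.image (Fin.cons a w : Fin (n + 1) → α) = insert a (Finset.univ.image w) := by
  ext b
  simp only [Finset.mem_image, Finset.mem_univ, true_and, Finset.mem_insert, Fin.exists_fin_succ,
    Fin.cons_zero, Fin.cons_succ]
  tauto

theorem card_image_eq_succ (n : ℕ) (C : Finset α) :
    Nat.card {w : Fin (n + 1) → α // Finset.univ.image w = C} =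
      ∑ a : C, (Nat.card {w : Fin n → α // Finset.univ.image w = C} +
        Nat.card {w : Fin n → α // Finset.univ.image w = C.erase a}) := by
  let e : (Σ a : C, ({w : Fin n → α // Finset.univ.image w = C} ⊕
      {w : Fin n → α // Finset.univ.image w = C.erase a})) →
      {w : Fin (n + 1) → α // Finset.univ.image w = C} := fun p =>
    ⟨Fin.cons p.1.1 (Sum.elim Subtype.val Subtype.val p.2), by
      obtain ⟨a, w | w⟩ := p
      · rw [image_fin_cons, Sum.elim_inl, w.2, Finset.insert_eq_of_mem a.2]
      · rw [image_fin_cons, Sum.elim_inr, w.2, Finset.insert_erase a.2]⟩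
  have he : Function.Bijective e := by
    constructor
    · rintro ⟨a, w⟩ ⟨a', w'⟩ h
      have h1 := congrArg Subtype.val h
      obtain ⟨h2, h3⟩ := Fin.cons_injective2 (α := fun _ => α) h1
      obtain rfl : a = a' := Subtype.ext h2
      have hne : C ≠ C.erase a := fun h =>
        Finset.notMem_erase a.1 C (h.subset a.2)
      rcases w with w | w <;> rcases w' with w' | w' <;> simp only [Sum.elim_inl, Sum.elim_inr] at h3
      · rw [Subtype.ext h3]
      · exact absurd (w.2.symm.trans (h3 ▸ w'.2)) hne
      · exact absurd (w'.2.symm.trans (h3 ▸ w.2)) hne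
      · rw [Subtype.ext h3]
    · rintro ⟨w, hw⟩
      have h0 : w 0 ∈ C := by
        rw [← hw]
        exact Finset.mem_image_of_mem _ (Finset.mem_univ _)
      have hins : insert (w 0) (Finset.univ.image (Fin.tail w)) = C := by
        rw [← image_fin_cons, Fin.cons_self_tail, hw]
      by_cases hmem : w 0 ∈ Finset.univ.image (Fin.tail w)
      · refine ⟨⟨⟨w 0, h0⟩, Sum.inl ⟨Fin.tail w, ?_⟩⟩, Subtype.ext (Fin.cons_self_tail w)⟩
        rwa [Finset.insert_eq_of_mem hmem] at hins
      · refine ⟨⟨⟨w 0, h0⟩, Sum.inr ⟨Fin.tail w, ?_⟩⟩, Subtype.ext (Fin.cons_self_tail w)⟩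
        exact (Finset.erase_insert hmem).symm.trans (congrArg (fun D => D.erase (w 0)) hins)
  rw [← Nat.card_congr (Equiv.ofBijective e he), Nat.card_sigma]
  simp only [Nat.card_sum]

/-- The number of surjections from `Fin n` onto a finite set. -/
theorem card_image_eq (n : ℕ) (C : Finset α) :
    Nat.card {w : Fin n → α // Finset.univ.image w = C} =
      C.card.factorial * n.stirlingSecond C.card := by
  induction n generalizing C with
  | zero =>
    rcases C.eq_empty_or_nonempty with rfl | hC
    · have : Nonempty {w : Fin 0 → α // Finset.univ.image w = ∅} := ⟨⟨Fin.elim0, rfl⟩⟩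
      have : Subsingleton {w : Fin 0 → α // Finset.univ.image w = ∅} :=
        ⟨fun a b => Subtype.ext (Subsingleton.elim _ _)⟩
      simp
    · have : IsEmpty {w : Fin 0 → α // Finset.univ.image w = C} :=
        ⟨fun w => hC.ne_empty (by rw [← w.2]; rfl)⟩
      obtain ⟨m, hm⟩ := Nat.exists_eq_succ_of_ne_zero hC.card_pos.ne'
      rw [hm, Nat.stirlingSecond_zero_succ, mul_zero, Nat.card_of_isEmpty]
  | succ n ih =>
    rw [card_image_eq_succ]
    have h1 : ∀ a : C, Nat.card {w : Fin n → α // Finset.univ.image w = C} +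
        Nat.card {w : Fin n → α // Finset.univ.image w = C.erase a} =
        C.card.factorial * n.stirlingSecond C.card +
          (C.card - 1).factorial * n.stirlingSecond (C.card - 1) := fun a => by
      rw [ih, ih, Finset.card_erase_of_mem a.2]
    rw [Finset.sum_congr rfl fun a _ => h1 a, Finset.sum_const, Finset.card_univ,
      Fintype.card_coe, smul_eq_mul]
    rcases hm : C.card with _ | m
    · simp
    · rw [Nat.stirlingSecond_succ_succ, Nat.add_sub_cancel, Nat.factorial_succ]
      ring

/-- The number of canonical sets of `m` intervals. -/
noncomputable def canonicalCount (m : ℕ) : ℕ :=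
  Nat.card {C : Finset (ℕ × ℕ) // IsCanonical C ∧ C.card = m}

theorem IsCanonical.subset {C : Finset (ℕ × ℕ)} (hC : IsCanonical C) :
    C ⊆ Finset.range C.card ×ˢ Finset.range C.card := by
  obtain ⟨-, k, hl, hr⟩ := hC
  have hk : k ≤ C.card := by
    rw [← Finset.card_range k, ← hl]; exact Finset.card_image_le
  intro p hp
  have h1 : p.1 ∈ Finset.range k := hl ▸ Finset.mem_image_of_mem _ hp
  have h2 : p.2 ∈ Finset.range k := hr ▸ Finset.mem_image_of_mem _ hp
  rw [Finset.mem_range] at h1 h2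
  rw [Finset.mem_product, Finset.mem_range, Finset.mem_range]
  exact ⟨h1.trans_le hk, h2.trans_le hk⟩

instance finite_isCanonical (m : ℕ) :
    Finite {C : Finset (ℕ × ℕ) // IsCanonical C ∧ C.card = m} :=
  Finite.of_injective
    (fun C => (⟨C.1, by
      rw [Finset.mem_powerset]
      have := C.2.1.subset
      rwa [C.2.2] at this⟩ : (Finset.range m ×ˢ Finset.range m).powerset))
    fun _ _ h => Subtype.ext (Subtype.mk.inj h)

theorem card_canonicalMap_card_image_eq (n m : ℕ) :
    Nat.card {w : CanonicalMap n // (Finset.univ.image w.1).card = m} =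
      m.factorial * canonicalCount m * n.stirlingSecond m := by
  let f : (Σ C : {C : Finset (ℕ × ℕ) // IsCanonical C ∧ C.card = m},
      {w : Fin n → ℕ × ℕ // Finset.univ.image w = C}) →
      {w : CanonicalMap n // (Finset.univ.image w.1).card = m} := fun p =>
    ⟨⟨p.2.1, by rw [p.2.2]; exact p.1.2.1⟩, by rw [p.2.2]; exact p.1.2.2⟩
  have hf : Function.Bijective f := by
    constructor
    · rintro ⟨⟨C, hC⟩, ⟨w, hw⟩⟩ ⟨⟨C', hC'⟩, ⟨w', hw'⟩⟩ h
      have h1 : w = w' := congrArg (fun w => w.1.1) h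
      subst h1
      simp only at hw hw'
      subst hw
      subst hw'
      rfl
    · rintro ⟨⟨w, hw⟩, hm⟩
      exact ⟨⟨⟨_, hw, hm⟩, ⟨w, rfl⟩⟩, rfl⟩
  have := Fintype.ofFinite {C : Finset (ℕ × ℕ) // IsCanonical C ∧ C.card = m}
  rw [← Nat.card_congr (Equiv.ofBijective f hf), Nat.card_sigma]
  have h1 : ∀ C : {C : Finset (ℕ × ℕ) // IsCanonical C ∧ C.card = m},
      Nat.card {w : Fin n → ℕ × ℕ // Finset.univ.image w = C} =
        m.factorial * n.stirlingSecond m := fun C => by rw [card_image_eq, C.2.2]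
  rw [Finset.sum_congr rfl fun C _ => h1 C, Finset.sum_const, Finset.card_univ, smul_eq_mul,
    ← Nat.card_eq_fintype_card, canonicalCount]
  ring

theorem card_image_univ_le {n : ℕ} (w : Fin n → α) : (Finset.univ.image w).card ≤ n := by
  simpa using Finset.card_image_le (s := Finset.univ) (f := w)

theorem labelledIntervalOrderCount_eq_sum (n : ℕ) :
    labelledIntervalOrderCount n = ∑ j ∈ Finset.range (n + 1),
      (n - j).factorial * canonicalCount (n - j) * n.stirlingSecond (n - j) := by
  rw [labelledIntervalOrderCount_eq_card_canonicalMap]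
  have h1 : Nat.card (CanonicalMap n) = ∑ m : Fin (n + 1),
      Nat.card {w : CanonicalMap n // (Finset.univ.image w.1).card = m} := by
    let f : CanonicalMap n → Fin (n + 1) := fun w =>
      ⟨(Finset.univ.image w.1).card, Nat.lt_succ_of_le (card_image_univ_le w.1)⟩
    rw [← Nat.card_congr (Equiv.sigmaFiberEquiv f), Nat.card_sigma]
    refine Finset.sum_congr rfl fun m _ => Nat.card_congr (Equiv.subtypeEquivRight fun w => ?_)
    exact Fin.ext_iff
  rw [h1, Finset.sum_congr rfl fun (m : Fin (n + 1)) _ => card_canonicalMap_card_image_eq n (m : ℕ),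
    Fin.sum_univ_eq_sum_range (fun m => m.factorial * canonicalCount m * n.stirlingSecond m),
    ← Finset.sum_range_reflect]
  refine Finset.sum_congr rfl fun j hj => ?_
  rw [show n + 1 - 1 - j = n - j by omega]

theorem factorial_mul_canonicalCount_le (m : ℕ) :
    m.factorial * canonicalCount m ≤ labelledIntervalOrderCount m := by
  have h := card_canonicalMap_card_image_eq m m
  rw [Nat.stirlingSecond_self, mul_one] at h
  rw [← h, labelledIntervalOrderCount_eq_card_canonicalMap]
  exact Nat.card_le_card_of_injective _ Subtype.val_injective

end ImageSize

section DuplicatePairs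

/-- Three distinct indices share the same interval. -/
def CanonicalMap.HasTriple {n : ℕ} (w : CanonicalMap n) : Prop :=
  ∃ x y z, x ≠ y ∧ x ≠ z ∧ y ≠ z ∧ w.1 x = w.1 y ∧ w.1 x = w.1 z

theorem CanonicalMap.dupPairCount_of_not_hasTriple {n : ℕ} {w : CanonicalMap n}
    (hw : ¬ w.HasTriple) :
    dupPairCount (equivRel n w) = n - (Finset.univ.image w.1).card := by
  set I := Finset.univ.image w.1 with hI
  set F : ℕ × ℕ → Finset (Fin n) := fun c => Finset.univ.filter fun x => w.1 x = c with hF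
  have memF : ∀ x c, x ∈ F c ↔ w.1 x = c := fun x c => by simp [hF]
  have hF2 : ∀ c, (F c).card ≤ 2 := by
    intro c
    by_contra! h
    obtain ⟨x, y, z, hx, hy, hz, hxy, hxz, hyz⟩ := Finset.two_lt_card_iff.mp h
    rw [memF] at hx hy hz
    exact hw ⟨x, y, z, hxy, hxz, hyz, hx.trans hy.symm, hx.trans hz.symm⟩
  have hF1 : ∀ c ∈ I, (F c).card = 1 + if (F c).card = 2 then 1 else 0 := by
    intro c hc
    obtain ⟨x, -, hx⟩ := Finset.mem_image.mp hc
    have h1 : 0 < (F c).card := Finset.card_pos.mpr ⟨x, (memF x c).mpr hx⟩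
    have h2 := hF2 c
    split_ifs <;> omega
  have hn : n = I.card + (I.filter fun c => (F c).card = 2).card := by
    have h1 := Finset.card_eq_sum_card_image w.1 Finset.univ
    rw [Finset.sum_congr rfl hF1, Finset.sum_add_distrib, Finset.card_filter] at *
    simpa using h1
  have hpairs : {s : Finset (Fin n) | ∃ x y, DupHoldings (equivRel n w) x y ∧ s = {x, y}} =
      ((I.filter fun c => (F c).card = 2).image F : Finset (Finset (Fin n))) := by
    ext s
    simp only [Set.mem_ofPred_eq, Finset.coe_image, Set.mem_image, Finset.coe_filter,
      dupHoldings_equivRel]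
    constructor
    · rintro ⟨x, y, ⟨hxy, hwxy⟩, rfl⟩
      have hsub : {x, y} ⊆ F (w.1 x) := by
        intro z hz
        rw [Finset.mem_insert, Finset.mem_singleton] at hz
        rcases hz with rfl | rfl
        · exact (memF _ _).mpr rfl
        · exact (memF _ _).mpr hwxy.symm
      have heq : {x, y} = F (w.1 x) :=
        Finset.eq_of_subset_of_card_le hsub (by rw [Finset.card_pair hxy]; exact hF2 _)
      exact ⟨w.1 x, ⟨Finset.mem_image_of_mem _ (Finset.mem_univ _),
        by rw [← heq, Finset.card_pair hxy]⟩, heq.symm⟩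
    · rintro ⟨c, ⟨-, hc⟩, rfl⟩
      obtain ⟨x, y, hxy, h⟩ := Finset.card_eq_two.mp hc
      have hx : w.1 x = c := (memF x c).mp (by rw [h]; simp)
      have hy : w.1 y = c := (memF y c).mp (by rw [h]; simp)
      exact ⟨x, y, ⟨hxy, hx.trans hy.symm⟩, h⟩
  have hcount : dupPairCount (equivRel n w) = (I.filter fun c => (F c).card = 2).card := by
    rw [dupPairCount, ← Set.coe_ofPred, hpairs, Nat.card_coe_set_eq, Set.ncard_coe_finset,
      Finset.card_image_of_injOn]
    intro c hc c' _ h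
    obtain ⟨x, -, hx⟩ := Finset.mem_image.mp (Finset.mem_filter.mp hc).1
    have h1 := (memF x c).mpr hx
    rw [h, memF] at h1
    exact hx.symm.trans h1
  omega

theorem card_hasTriple_le (m : ℕ) :
    Nat.card {w : CanonicalMap (m + 2) // w.HasTriple} ≤
      (m + 2) ^ 3 * labelledIntervalOrderCount m := by
  have hex : ∀ w : {w : CanonicalMap (m + 2) // w.HasTriple},
      ∃ (x y : Fin (m + 2)) (z : Fin (m + 1)), x ≠ y ∧ x ≠ y.succAbove z ∧
        w.1.1 x = w.1.1 y ∧ w.1.1 x = w.1.1 (y.succAbove z) := by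
    rintro ⟨w, x, y, z, hxy, hxz, hyz, h1, h2⟩
    obtain ⟨z', rfl⟩ := Fin.exists_succAbove_eq hyz.symm
    exact ⟨x, y, z', hxy, hxz, h1, h2⟩
  choose X Y Z hXY hXZ h1 h2 using hex
  have hcover : ∀ w : {w : CanonicalMap (m + 2) // w.HasTriple}, ∀ v, v ≠ Y w →
      v ≠ (Y w).succAbove (Z w) → ∃ u, (Y w).succAbove ((Z w).succAbove u) = v := by
    intro w v hv1 hv2
    obtain ⟨v', rfl⟩ := Fin.exists_succAbove_eq hv1
    have hv' : v' ≠ Z w := fun h => hv2 (by rw [h])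
    obtain ⟨u, rfl⟩ := Fin.exists_succAbove_eq hv'
    exact ⟨u, rfl⟩
  let g : {w : CanonicalMap (m + 2) // w.HasTriple} →
      (Fin (m + 2) × Fin (m + 2) × Fin (m + 1)) × CanonicalMap m := fun w =>
    ((X w, Y w, Z w), ⟨fun u => w.1.1 ((Y w).succAbove ((Z w).succAbove u)), by
      have : Finset.univ.image (fun u => w.1.1 ((Y w).succAbove ((Z w).succAbove u))) =
          Finset.univ.image w.1.1 := by
        ext c
        simp only [Finset.mem_image, Finset.mem_univ, true_and]
        constructor
        · rintro ⟨u, hu⟩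
          exact ⟨_, hu⟩
        · rintro ⟨v, rfl⟩
          obtain ⟨u, hu⟩ := hcover w _ (hXY w) (hXZ w)
          by_cases hv1 : v = Y w
          · exact ⟨u, by rw [hu, hv1, h1]⟩
          · by_cases hv2 : v = (Y w).succAbove (Z w)
            · exact ⟨u, by rw [hu, hv2, h2]⟩
            · obtain ⟨u', hu'⟩ := hcover w v hv1 hv2
              exact ⟨u', by rw [hu']⟩
      rw [this]
      exact w.1.2⟩)
  have hg : Function.Injective g := by
    intro w w' h
    obtain ⟨h3, h4⟩ := Prod.mk.inj h
    obtain ⟨hx, h5⟩ := Prod.mk.inj h3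
    obtain ⟨hy, hz⟩ := Prod.mk.inj h5
    have h6 := congrFun (congrArg Subtype.val h4)
    simp only [← hy, ← hz] at h6
    have hX : w.1.1 (X w) = w'.1.1 (X w) := by
      obtain ⟨u, hu⟩ := hcover w _ (hXY w) (hXZ w)
      rw [← hu, h6]
    refine Subtype.ext (Subtype.ext (funext fun v => ?_))
    by_cases hv1 : v = Y w
    · rw [hv1, ← h1, hX, hx, h1, hy]
    · by_cases hv2 : v = (Y w).succAbove (Z w)
      · rw [hv2, ← h2, hX, hx, h2, hy, hz]
      · obtain ⟨u, rfl⟩ := hcover w v hv1 hv2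
        exact h6 u
  refine (Nat.card_le_card_of_injective g hg).trans ?_
  rw [Nat.card_prod, Nat.card_prod, Nat.card_prod, Nat.card_fin, Nat.card_fin,
    labelledIntervalOrderCount_eq_card_canonicalMap]
  refine Nat.mul_le_mul_right _ ?_
  nlinarith [Nat.zero_le m]

theorem card_dupPairCount_eq (n j : ℕ) :
    Nat.card {P : IntervalOrderRel n // dupPairCount P = j} =
      Nat.card {w : CanonicalMap n // dupPairCount (CanonicalMap.equivRel n w) = j} :=
  (Nat.card_congr ((CanonicalMap.equivRel n).subtypeEquiv fun _ => Iff.rfl)).symm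

theorem card_subtype_le_add {β : Type*} [Finite β] {p q t : β → Prop}
    (h : ∀ b, ¬ t b → p b → q b) :
    Nat.card {b // p b} ≤ Nat.card {b // q b} + Nat.card {b // t b} := by
  have h1 : {b | p b} ⊆ {b | q b} ∪ {b | t b} := fun b hb => by
    by_cases hb' : t b
    · exact Or.inr hb'
    · exact Or.inl (h b hb' hb)
  exact (Set.ncard_le_ncard h1 (Set.toFinite _)).trans (Set.ncard_union_le _ _)

/-- Up to orders with three mutually duplicated elements, the number of interval orders with `j`
duplicated pairs is the number of those with `n - j` distinct intervals. -/
theorem abs_card_dupPairCount_sub_le {m j : ℕ} (hj : j ≤ m + 2) :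
    |(Nat.card {P : IntervalOrderRel (m + 2) // dupPairCount P = j} : ℝ) -
      ((m + 2 - j).factorial * canonicalCount (m + 2 - j) *
        (m + 2).stirlingSecond (m + 2 - j) : ℕ)| ≤
      ((m + 2) ^ 3 * labelledIntervalOrderCount m : ℕ) := by
  have hT := card_hasTriple_le m
  rw [← card_canonicalMap_card_image_eq, card_dupPairCount_eq]
  have hle := fun w : CanonicalMap (m + 2) => card_image_univ_le w.1
  have h1 := card_subtype_le_add (β := CanonicalMap (m + 2)) (t := CanonicalMap.HasTriple)
    (p := fun w => dupPairCount (CanonicalMap.equivRel (m + 2) w) = j)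
    (q := fun w => (Finset.univ.image w.1).card = m + 2 - j) fun w hw hp => by
      rw [CanonicalMap.dupPairCount_of_not_hasTriple hw] at hp
      have := hle w
      omega
  have h2 := card_subtype_le_add (β := CanonicalMap (m + 2)) (t := CanonicalMap.HasTriple)
    (p := fun w => (Finset.univ.image w.1).card = m + 2 - j)
    (q := fun w => dupPairCount (CanonicalMap.equivRel (m + 2) w) = j) fun w hw hp => by
      rw [CanonicalMap.dupPairCount_of_not_hasTriple hw]
      omega
  have h1' := h1.trans (Nat.add_le_add_left hT _)
  have h2' := h2.trans (Nat.add_le_add_left hT _)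
  rw [abs_sub_le_iff, sub_le_iff_le_add, sub_le_iff_le_add]
  constructor
  · rw [add_comm (Nat.cast _ : ℝ)]; exact_mod_cast h1'
  · rw [add_comm (Nat.cast _ : ℝ)]; exact_mod_cast h2'

end DuplicatePairs

section StirlingBounds

theorem succ_pow_succ_le (k N : ℕ) : (k + 1) ^ (N + 1) ≤ (N + 1) * (k + 1) ^ N + k ^ (N + 1) := by
  induction N with
  | zero => simp [add_comm]
  | succ N ih =>
    have h : k ^ (N + 1) ≤ (k + 1) ^ (N + 1) := Nat.pow_le_pow_left k.le_succ _
    calc (k + 1) ^ (N + 1 + 1) = k * (k + 1) ^ (N + 1) + (k + 1) ^ (N + 1) := by ring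
      _ ≤ k * ((N + 1) * (k + 1) ^ N + k ^ (N + 1)) + (k + 1) ^ (N + 1) := by gcongr
      _ ≤ (k + 1) * ((N + 1) * (k + 1) ^ N) + k * k ^ (N + 1) + (k + 1) ^ (N + 1) := by
        nlinarith [Nat.zero_le ((N + 1) * (k + 1) ^ N)]
      _ = (N + 1 + 1) * (k + 1) ^ (N + 1) + k ^ (N + 1 + 1) := by ring

theorem mul_pow_add_pow_succ_le (x N : ℕ) : (N + 1) * x ^ N + x ^ (N + 1) ≤ (x + 1) ^ (N + 1) := by
  induction N with
  | zero => simp [add_comm]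
  | succ N ih =>
    calc (N + 1 + 1) * x ^ (N + 1) + x ^ (N + 1 + 1)
        ≤ ((N + 1) * x ^ N + x ^ (N + 1)) * (x + 1) := by
          have : 0 ≤ (N + 1) * x ^ N := Nat.zero_le _
          have h2 : ((N + 1) * x ^ N + x ^ (N + 1)) * (x + 1) =
            (N + 1 + 1) * x ^ (N + 1) + x ^ (N + 1 + 1) + (N + 1) * x ^ N := by ring
          omega
      _ ≤ (x + 1) ^ (N + 1) * (x + 1) := by gcongr
      _ = (x + 1) ^ (N + 1 + 1) := by ring

theorem stirlingSecond_add_succ (k j : ℕ) :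
    (k + 1 + (j + 1)).stirlingSecond (k + 1) =
      (k + 1) * (k + 1 + j).stirlingSecond (k + 1) + (k + (j + 1)).stirlingSecond k := by
  rw [show k + 1 + (j + 1) = k + 1 + j + 1 by ring, Nat.stirlingSecond_succ_succ,
    show k + 1 + j = k + (j + 1) by ring]

theorem pow_le_mul_stirlingSecond (j k : ℕ) :
    k ^ (2 * j) ≤ 2 ^ j * j.factorial * (k + j).stirlingSecond k := by
  induction j generalizing k with
  | zero => simp [Nat.stirlingSecond_self]
  | succ j ih =>
    induction k with
    | zero => simp [mul_add]
    | succ k ihk =>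
      rw [stirlingSecond_add_succ]
      have h := succ_pow_succ_le k (2 * j + 1)
      have h1 := Nat.mul_le_mul_left ((2 * j + 2) * (k + 1)) (ih (k + 1))
      calc (k + 1) ^ (2 * (j + 1)) ≤ (2 * j + 2) * (k + 1) * (k + 1) ^ (2 * j) +
            k ^ (2 * (j + 1)) := by
            refine h.trans_eq ?_
            ring
        _ ≤ (2 * j + 2) * (k + 1) *
              (2 ^ j * j.factorial * (k + 1 + j).stirlingSecond (k + 1)) +
            2 ^ (j + 1) * (j + 1).factorial * (k + (j + 1)).stirlingSecond k :=
          Nat.add_le_add h1 ihk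
        _ = _ := by
          rw [Nat.factorial_succ]
          ring

theorem mul_stirlingSecond_le_pow (j k : ℕ) :
    2 ^ j * j.factorial * (k + j).stirlingSecond k ≤ (k + j) ^ (2 * j) := by
  induction j generalizing k with
  | zero => simp [Nat.stirlingSecond_self]
  | succ j ih =>
    induction k with
    | zero => simp
    | succ k ihk =>
      rw [stirlingSecond_add_succ]
      have h := mul_pow_add_pow_succ_le (k + 1 + j) (2 * j + 1)
      have h1 := Nat.mul_le_mul_left ((2 * j + 2) * (k + 1)) (ih (k + 1))
      calc _ = (2 * j + 2) * (k + 1) *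
              (2 ^ j * j.factorial * (k + 1 + j).stirlingSecond (k + 1)) +
            2 ^ (j + 1) * (j + 1).factorial * (k + (j + 1)).stirlingSecond k := by
            rw [Nat.factorial_succ]
            ring
        _ ≤ (2 * j + 2) * (k + 1) * (k + 1 + j) ^ (2 * j) + (k + (j + 1)) ^ (2 * (j + 1)) :=
          Nat.add_le_add h1 ihk
        _ ≤ (2 * j + 2) * (k + 1 + j) * (k + 1 + j) ^ (2 * j) +
            (k + (j + 1)) ^ (2 * (j + 1)) := by
          refine Nat.add_le_add_right (Nat.mul_le_mul_right _ (Nat.mul_le_mul_left _ ?_)) _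
          omega
        _ = (2 * j + 1 + 1) * (k + 1 + j) ^ (2 * j + 1) + (k + 1 + j) ^ (2 * j + 1 + 1) := by ring
        _ ≤ _ := h
        _ = _ := by ring

theorem stirlingSecond_add_le (k j : ℕ) :
    (k + j).stirlingSecond k ≤ (k + j).choose j * k ^ j := by
  induction j generalizing k with
  | zero => simp [Nat.stirlingSecond_self]
  | succ j ih =>
    induction k with
    | zero => simp
    | succ k ihk =>
      rw [stirlingSecond_add_succ]
      have h1 := Nat.mul_le_mul_left (k + 1) (ih (k + 1))
      have h2 : k ^ (j + 1) ≤ (k + 1) ^ (j + 1) := Nat.pow_le_pow_left k.le_succ _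
      calc _ ≤ (k + 1) * ((k + 1 + j).choose j * (k + 1) ^ j) +
            (k + (j + 1)).choose (j + 1) * k ^ (j + 1) := Nat.add_le_add h1 ihk
        _ ≤ (k + 1) * ((k + 1 + j).choose j * (k + 1) ^ j) +
            (k + (j + 1)).choose (j + 1) * (k + 1) ^ (j + 1) := by gcongr
        _ = _ := by
          rw [show k + 1 + (j + 1) = (k + 1 + j) + 1 by ring, Nat.choose_succ_succ,
            show k + (j + 1) = k + 1 + j by ring]
          ring

theorem factorial_mul_stirlingSecond_le (k j : ℕ) :
    j.factorial * (k + j).stirlingSecond k ≤ (k + j).descFactorial j ^ 2 := by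
  have h1 : k ^ j ≤ (k + j).descFactorial j :=
    (Nat.pow_le_pow_left (by omega) j).trans (Nat.pow_sub_le_descFactorial (k + j) j)
  calc _ ≤ j.factorial * ((k + j).choose j * k ^ j) :=
        Nat.mul_le_mul_left _ (stirlingSecond_add_le k j)
    _ = (k + j).descFactorial j * k ^ j := by
        rw [Nat.descFactorial_eq_factorial_mul_choose]
        ring
    _ ≤ _ := by
        rw [sq]
        exact Nat.mul_le_mul_left _ h1

theorem tendsto_stirlingSecond_div (j : ℕ) :
    Filter.Tendsto (fun k : ℕ => ((k + j).stirlingSecond k : ℝ) / (k : ℝ) ^ (2 * j)) Filter.atTop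
      (nhds (1 / (2 ^ j * j.factorial))) := by
  have h2 : (0 : ℝ) < 2 ^ j * j.factorial := by positivity
  have hup : Filter.Tendsto (fun k : ℕ => (1 + (j : ℝ) / k) ^ (2 * j) / (2 ^ j * j.factorial))
      Filter.atTop (nhds (1 / (2 ^ j * j.factorial))) := by
    have := ((tendsto_const_div_atTop_nhds_zero_nat (j : ℝ)).const_add 1).pow (2 * j)
    simpa using this.div_const (2 ^ j * (j.factorial : ℝ))
  refine tendsto_of_tendsto_of_tendsto_of_le_of_le' tendsto_const_nhds hup ?_ ?_
  all_goals
    filter_upwards [Filter.eventually_gt_atTop 0] with k hk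
    have hk' : (0 : ℝ) < k := Nat.cast_pos.mpr hk
  · have h : (k : ℝ) ^ (2 * j) ≤ 2 ^ j * j.factorial * (k + j).stirlingSecond k := by
      exact_mod_cast pow_le_mul_stirlingSecond j k
    rw [div_le_div_iff₀ h2 (by positivity)]
    linarith
  · have h : (2 : ℝ) ^ j * j.factorial * (k + j).stirlingSecond k ≤ (k + j) ^ (2 * j) := by
      exact_mod_cast mul_stirlingSecond_le_pow j k
    rw [div_le_div_iff₀ (by positivity) h2, ← mul_pow, add_mul, div_mul_cancel₀ _ hk'.ne', one_mul]
    linarith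

end StirlingBounds

section PoissonLimit

variable {l : ℕ → ℝ} {c : ℝ}

theorem tendsto_pow_mul_div (hpos : ∀ n, 0 < l n)
    (hl : Filter.Tendsto (fun n : ℕ => ((n : ℝ) + 1) ^ 2 * l n / l (n + 1)) Filter.atTop (nhds c))
    (j : ℕ) :
    Filter.Tendsto (fun k : ℕ => (k : ℝ) ^ (2 * j) * l k / l (k + j)) Filter.atTop
      (nhds (c ^ j)) := by
  induction j with
  | zero =>
    simp only [mul_zero, pow_zero, one_mul, add_zero]
    exact tendsto_const_nhds.congr fun k => (div_self (hpos k).ne').symm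
  | succ j ih =>
    have h1 : Filter.Tendsto (fun k : ℕ => (k : ℝ) / ((k : ℝ) + (j + 1))) Filter.atTop (nhds 1) :=
      tendsto_natCast_div_add_atTop (𝕜 := ℝ) (j + 1 : ℝ)
    have h2 := hl.comp (Filter.tendsto_add_atTop_nat j)
    have h3 := ih.mul ((h1.pow 2).mul h2)
    rw [one_pow, one_mul, ← pow_succ] at h3
    refine h3.congr fun k => ?_
    have ha := (hpos (k + j)).ne'
    have hb := (hpos (k + j + 1)).ne'
    have hd : (k : ℝ) + j + 1 ≠ 0 := by positivity
    simp only [Function.comp_apply, Nat.cast_add, ← add_assoc]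
    field_simp
    ring

theorem descFactorial_sq_mul_le {C : ℝ} (hC0 : 0 ≤ C)
    (hC : ∀ n : ℕ, ((n : ℝ) + 1) ^ 2 * l n ≤ C * l (n + 1)) (k j : ℕ) :
    ((k + j).descFactorial j : ℝ) ^ 2 * l k ≤ C ^ j * l (k + j) := by
  induction j with
  | zero => simp
  | succ j ih =>
    rw [← add_assoc, Nat.succ_descFactorial_succ]
    calc _ = ((k + j : ℕ) + 1 : ℝ) ^ 2 * (((k + j).descFactorial j : ℝ) ^ 2 * l k) := by
          push_cast
          ring
      _ ≤ ((k + j : ℕ) + 1 : ℝ) ^ 2 * (C ^ j * l (k + j)) := by gcongr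
      _ = C ^ j * (((k + j : ℕ) + 1 : ℝ) ^ 2 * l (k + j)) := by ring
      _ ≤ C ^ j * (C * l (k + j + 1)) :=
          mul_le_mul_of_nonneg_left (hC (k + j)) (pow_nonneg hC0 j)
      _ = _ := by ring

theorem tendsto_stirlingSecond_mul_div (hpos : ∀ n, 0 < l n)
    (hl : Filter.Tendsto (fun n : ℕ => ((n : ℝ) + 1) ^ 2 * l n / l (n + 1)) Filter.atTop (nhds c))
    (j : ℕ) :
    Filter.Tendsto (fun n : ℕ => (n.stirlingSecond (n - j) : ℝ) * l (n - j) / l n) Filter.atTop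
      (nhds ((c / 2) ^ j / j.factorial)) := by
  rw [← Filter.tendsto_add_atTop_iff_nat j]
  have h := (tendsto_stirlingSecond_div j).mul (tendsto_pow_mul_div hpos hl j)
  rw [show 1 / (2 ^ j * (j.factorial : ℝ)) * c ^ j = (c / 2) ^ j / j.factorial by
    rw [div_pow]; field_simp] at h
  refine h.congr' ?_
  filter_upwards [Filter.eventually_gt_atTop 0] with k hk
  have hk' : (k : ℝ) ≠ 0 := Nat.cast_ne_zero.mpr hk.ne'
  have := (hpos (k + j)).ne'
  rw [Nat.add_sub_cancel]
  field_simp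

theorem exists_stirlingSecond_mul_div_le (hpos : ∀ n, 0 < l n)
    (hl : Filter.Tendsto (fun n : ℕ => ((n : ℝ) + 1) ^ 2 * l n / l (n + 1)) Filter.atTop
      (nhds c)) :
    ∃ C : ℝ, ∀ n j : ℕ, j ≤ n →
      (n.stirlingSecond (n - j) : ℝ) * l (n - j) / l n ≤ C ^ j / j.factorial := by
  obtain ⟨C, hC⟩ := hl.bddAbove_range
  have hC' : ∀ n : ℕ, ((n : ℝ) + 1) ^ 2 * l n / l (n + 1) ≤ C := fun n => hC ⟨n, rfl⟩
  have hC0 : 0 ≤ C := (div_nonneg (mul_nonneg (sq_nonneg _) (hpos 0).le) (hpos 1).le).trans (hC' 0)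
  refine ⟨C, fun n j hj => ?_⟩
  obtain ⟨k, rfl⟩ := Nat.exists_eq_add_of_le' hj
  rw [Nat.add_sub_cancel, div_le_div_iff₀ (hpos _) (by positivity)]
  have h1 : (j.factorial * (k + j).stirlingSecond k : ℝ) ≤ ((k + j).descFactorial j : ℝ) ^ 2 := by
    exact_mod_cast factorial_mul_stirlingSecond_le k j
  calc _ = (j.factorial * (k + j).stirlingSecond k : ℝ) * l k := by ring
    _ ≤ ((k + j).descFactorial j : ℝ) ^ 2 * l k := by
        gcongr
        exact (hpos k).le
    _ ≤ _ := descFactorial_sq_mul_le hC0 (fun n => (div_le_iff₀ (hpos _)).mp (hC' n)) k j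

theorem sum_exp_neg_mul_sum_exp (a : ℝ) (p : ℕ → ℝ) (n : ℕ) :
    ∑ i ∈ Finset.range (n + 1), (-a) ^ i / i.factorial *
      ∑ j ∈ Finset.range (n - i + 1), a ^ j / j.factorial * p (n - i - j) = p n := by
  have hcoeff : ∀ (b : ℝ) (F : PowerSeries ℝ) (m : ℕ),
      PowerSeries.coeff m (PowerSeries.rescale b (PowerSeries.exp ℝ) * F) =
        ∑ j ∈ Finset.range (m + 1), b ^ j / j.factorial * PowerSeries.coeff (m - j) F := by
    intro b F m
    rw [PowerSeries.coeff_mul, Finset.Nat.sum_antidiagonal_eq_sum_range_succ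
      fun i j => PowerSeries.coeff i (PowerSeries.rescale b (PowerSeries.exp ℝ)) *
        PowerSeries.coeff j F]
    refine Finset.sum_congr rfl fun j _ => ?_
    rw [PowerSeries.coeff_rescale, PowerSeries.coeff_exp]
    simp [div_eq_mul_inv]
  have h : PowerSeries.rescale (-a) (PowerSeries.exp ℝ) *
      (PowerSeries.rescale a (PowerSeries.exp ℝ) * PowerSeries.mk p) = PowerSeries.mk p := by
    rw [← mul_assoc, PowerSeries.exp_mul_exp_eq_exp_add, neg_add_cancel, PowerSeries.rescale_zero]
    simp
  have h1 := congrArg (PowerSeries.coeff n) h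
  simpa only [hcoeff, PowerSeries.coeff_mk] using h1

/-- If the convolution of a bounded sequence with the weights `a ^ j / j!` tends to `1`, the
sequence tends to `exp (-a)`. -/
theorem tendsto_exp_neg_of_sum {a : ℝ} {p : ℕ → ℝ}
    (h : Filter.Tendsto
      (fun n => ∑ j ∈ Finset.range (n + 1), a ^ j / j.factorial * p (n - j)) Filter.atTop
      (nhds 1)) :
    Filter.Tendsto p Filter.atTop (nhds (Real.exp (-a))) := by
  set y : ℕ → ℝ := fun n => ∑ j ∈ Finset.range (n + 1), a ^ j / j.factorial * p (n - j) with hy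
  obtain ⟨M, hM⟩ := h.norm.bddAbove_range
  have hM' : ∀ n, ‖y n‖ ≤ M := fun n => hM ⟨n, rfl⟩
  have h1 := tendsto_sum_range_of_dominated (f := fun n i => (-a) ^ i / i.factorial * y (n - i))
    (L := fun i => (-a) ^ i / i.factorial) (bound := fun i => |a| ^ i / i.factorial * M)
    ((Real.summable_pow_div_factorial |a|).mul_right M)
    (fun n i _ => by
      rw [norm_mul, norm_div, norm_pow, norm_neg, Real.norm_natCast, Real.norm_eq_abs]
      gcongr
      exact hM' _)
    (fun i => by
      simpa using (h.comp (Filter.tendsto_sub_atTop_nat i)).const_mul ((-a) ^ i / i.factorial))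
  rw [Real.exp_eq_exp_ℝ, NormedSpace.exp_eq_tsum_div]
  exact h1.congr fun n => sum_exp_neg_mul_sum_exp a p n

theorem tendsto_of_stirlingSecond_sum (hpos : ∀ n, 0 < l n)
    (hl : Filter.Tendsto (fun n : ℕ => ((n : ℝ) + 1) ^ 2 * l n / l (n + 1)) Filter.atTop (nhds c))
    {q : ℕ → ℝ} (hq0 : ∀ n, 0 ≤ q n) (hq : ∀ n, q n ≤ l n)
    (hsum : ∀ n, l n = ∑ j ∈ Finset.range (n + 1), q (n - j) * n.stirlingSecond (n - j)) (j : ℕ) :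
    Filter.Tendsto (fun n : ℕ => q (n - j) * n.stirlingSecond (n - j) / l n) Filter.atTop
      (nhds (Real.exp (-(c / 2)) * (c / 2) ^ j / j.factorial)) := by
  set w : ℕ → ℕ → ℝ := fun n j => (n.stirlingSecond (n - j) : ℝ) * l (n - j) / l n with hw
  set p : ℕ → ℝ := fun n => q n / l n with hp
  have hp1 : ∀ n, ‖p n‖ ≤ 1 := fun n => by
    rw [Real.norm_of_nonneg (div_nonneg (hq0 n) (hpos n).le)]
    exact (div_le_one (hpos n)).mpr (hq n)
  have hwp : ∀ n j, q (n - j) * n.stirlingSecond (n - j) / l n = w n j * p (n - j) := fun n j => by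
    have := (hpos (n - j)).ne'
    simp only [hw, hp]
    field_simp
  have hwlim := tendsto_stirlingSecond_mul_div hpos hl
  obtain ⟨C, hC⟩ := exists_stirlingSecond_mul_div_le hpos hl
  have hsum1 : ∀ n, ∑ j ∈ Finset.range (n + 1), w n j * p (n - j) = 1 := fun n => by
    rw [← Finset.sum_congr rfl fun j _ => hwp n j, ← Finset.sum_div, ← hsum,
      div_self (hpos n).ne']
  have hdiff := tendsto_sum_range_of_dominated
    (f := fun n j => (w n j - (c / 2) ^ j / j.factorial) * p (n - j)) (L := fun _ => 0)
    (bound := fun j => C ^ j / j.factorial + |c / 2| ^ j / j.factorial)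
    ((Real.summable_pow_div_factorial C).add (Real.summable_pow_div_factorial |c / 2|))
    (fun n j hj => by
      rw [norm_mul]
      refine (mul_le_of_le_one_right (norm_nonneg _) (hp1 _)).trans ((norm_sub_le _ _).trans ?_)
      have hw0 : 0 ≤ w n j :=
        div_nonneg (mul_nonneg (Nat.cast_nonneg _) (hpos _).le) (hpos _).le
      rw [Real.norm_of_nonneg hw0, norm_div, norm_pow, Real.norm_natCast, Real.norm_eq_abs]
      exact add_le_add_left (hC n j hj) _)
    (fun j => by
      have h0 : Filter.Tendsto (fun n => w n j - (c / 2) ^ j / j.factorial) Filter.atTop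
          (nhds 0) := by
        simpa using (hwlim j).sub_const ((c / 2) ^ j / j.factorial)
      exact squeeze_zero_norm
        (fun n => (norm_mul_le _ _).trans (mul_le_of_le_one_right (norm_nonneg _) (hp1 _)))
        (by simpa using h0.norm))
  have hy : Filter.Tendsto
      (fun n => ∑ j ∈ Finset.range (n + 1), (c / 2) ^ j / j.factorial * p (n - j)) Filter.atTop
      (nhds 1) := by
    have := hdiff.const_sub 1
    rw [tsum_zero, sub_zero] at this
    refine this.congr fun n => ?_
    simp only [sub_mul, Finset.sum_sub_distrib, hsum1, sub_sub_cancel]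
  have hplim := (tendsto_exp_neg_of_sum hy).comp (Filter.tendsto_sub_atTop_nat j)
  have := (hwlim j).mul hplim
  rw [show (c / 2) ^ j / j.factorial * Real.exp (-(c / 2)) =
    Real.exp (-(c / 2)) * (c / 2) ^ j / j.factorial by ring] at this
  exact this.congr fun n => (hwp n j).symm

end PoissonLimit

theorem labelledIntervalOrderCount_pos (n : ℕ) : 0 < labelledIntervalOrderCount n := by
  have : Nonempty (IntervalOrderRel n) :=
    ⟨⟨fun _ _ => False, { irrefl := fun _ h => h, trans := fun _ _ _ h _ => h },
      fun _ _ _ _ h _ => h.elim⟩⟩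
  exact Nat.card_pos

theorem tendsto_sq_mul_labelledIntervalOrderCount_div :
    Filter.Tendsto (fun n : ℕ => ((n : ℝ) + 1) ^ 2 * (labelledIntervalOrderCount n : ℝ) /
      (labelledIntervalOrderCount (n + 1) : ℝ)) Filter.atTop (nhds (Real.pi ^ 2 / 6)) := by
  obtain ⟨ν, hν, heven, c, hc0, hc⟩ := exists_isStrangeMoments
  exact tendsto_sq_mul_div_of_momentMap heven hc0 hc
    (l := fun n => (labelledIntervalOrderCount n : ℝ))
    (fun n => Nat.cast_pos.mpr (labelledIntervalOrderCount_pos n))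
    fun n => by simpa using hν.labelledIntervalOrderCount_eq n

theorem tendsto_cube_mul_div {l : ℕ → ℝ} {c : ℝ} (hpos : ∀ n, 0 < l n)
    (hl : Filter.Tendsto (fun n : ℕ => ((n : ℝ) + 1) ^ 2 * l n / l (n + 1)) Filter.atTop
      (nhds c)) :
    Filter.Tendsto (fun m : ℕ => ((m : ℝ) + 2) ^ 3 * l m / l (m + 2)) Filter.atTop (nhds 0) := by
  have h1 := hl.mul (hl.comp (Filter.tendsto_add_atTop_nat 1))
  have hinv : Filter.Tendsto (fun m : ℕ => 1 / ((m : ℝ) + 1)) Filter.atTop (nhds 0) :=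
    tendsto_one_div_add_atTop_nhds_zero_nat
  have h2 : Filter.Tendsto (fun m : ℕ => (1 + 1 / ((m : ℝ) + 1)) * (1 / ((m : ℝ) + 1)))
      Filter.atTop (nhds 0) := by
    simpa using (hinv.const_add 1).mul hinv
  have h3 := h1.mul h2
  rw [mul_zero] at h3
  refine h3.congr fun m => ?_
  have ha := (hpos (m + 1)).ne'
  have hb := (hpos (m + 2)).ne'
  simp only [Function.comp_apply, Nat.cast_add, Nat.cast_one, add_assoc]
  norm_num
  field_simp
  ring

/-- For each fixed `j`, the proportion of labelled interval orders
on an `n`-element set with exactly `j` unordered pairs of distinct elements with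
duplicated holdings tends to `e^{-π²/12} (π²/12)^j / j!` as `n → ∞` (Poisson with
mean `π²/12`). -/
theorem labelled_dup_pairs_poisson (j : ℕ) :
    Filter.Tendsto
      (fun n : ℕ =>
        (Nat.card {P : IntervalOrderRel n // dupPairCount P = j} : ℝ) /
          (labelledIntervalOrderCount n : ℝ))
      Filter.atTop
      (nhds (Real.exp (-(Real.pi ^ 2 / 12)) * (Real.pi ^ 2 / 12) ^ j / j.factorial)) := by
  have hpos : ∀ n, 0 < (labelledIntervalOrderCount n : ℝ) := fun n =>
    Nat.cast_pos.mpr (labelledIntervalOrderCount_pos n)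
  have hl := tendsto_sq_mul_labelledIntervalOrderCount_div
  have hmain := tendsto_of_stirlingSecond_sum hpos hl
    (q := fun m => ((m.factorial * canonicalCount m : ℕ) : ℝ)) (fun _ => Nat.cast_nonneg _)
    (fun n => Nat.cast_le.mpr (factorial_mul_canonicalCount_le n))
    (fun n => by exact_mod_cast labelledIntervalOrderCount_eq_sum n) j
  rw [show Real.pi ^ 2 / 6 / 2 = Real.pi ^ 2 / 12 by ring] at hmain
  rw [← Filter.tendsto_add_atTop_iff_nat 2] at hmain ⊢
  refine (tendsto_iff_of_dist ?_).mpr hmain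
  refine squeeze_zero' (Filter.Eventually.of_forall fun _ => dist_nonneg) ?_
    (tendsto_cube_mul_div hpos hl)
  filter_upwards [Filter.eventually_ge_atTop j] with m hm
  have h := abs_card_dupPairCount_sub_le (m := m) (j := j) (by omega)
  rw [Real.dist_eq, ← sub_div, abs_div, abs_of_pos (hpos (m + 2))]
  refine div_le_div_of_nonneg_right ?_ (hpos (m + 2)).le
  push_cast at h ⊢
  exact h
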